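/- arXiv:0806.0151 — 3 statements merged into one kernel-verified Lean document; each statement's English description precedes it below -/
import Mathlib

section
/- Let (Ω, F, p) be a probability space and M : Ω → M_d(ℂ) a random reduced dynamics operator with fixed invariant unit vector ψ_S, and suppose p({ω : M(ω) ∈ ℳ_(E)}) > 0. Then there exists a set Ω_3 ⊆ Ω^{ℕ*} with ℙ(Ω_3) = 1 such that for every ω̄ ∈ Ω_3, lim_{N→∞} (1/N) Σ_{n=1}^N M(ω_1) M(ω_2) ⋯ M(ω_n) = |ψ_S⟩⟨θ| = P_{1,E[M]}, where θ := P_{1,E[M]}^* ψ_S and P_{1,E[M]} is the spectral projection of E[M] for the eigenvalue 1. -/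
open scoped BigOperators
open MeasureTheory Filter ContinuousLinearMap

noncomputable section

abbrev Evec (d : ℕ) := EuclideanSpace ℂ (Fin d)
abbrev Op (d : ℕ) := Evec d →L[ℂ] Evec d

/-- `ketBra u v = |u⟩⟨v|`, the rank-one operator `x ↦ ⟪v, x⟫ • u`. -/
def ketBra {d : ℕ} (u v : Evec d) : Op d := (innerSL ℂ v).smulRight u

/-- The spectral projection for the eigenvalue `1`, as the limit of Cesàro averages. -/
def cesaroProj {d : ℕ} (A : Op d) : Op d :=
  limUnder atTop (fun N : ℕ => (N : ℂ)⁻¹ • ∑ k ∈ Finset.range N, A ^ k)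

/-- The class `ℳ_(E)`. -/
def mcalE {d : ℕ} (ψS : Evec d) (A : Op d) : Prop :=
  (∃ Nrm : Seminorm ℂ (Evec d), (∀ x, Nrm x = 0 → x = 0) ∧ ∀ x, Nrm (A x) ≤ Nrm x) ∧
  A ψS = ψS ∧
  spectrum ℂ A ∩ {z : ℂ | ‖z‖ = 1} = {1} ∧
  Module.finrank ℂ (Module.End.maxGenEigenspace (A : Evec d →ₗ[ℂ] Evec d) 1) = 1

/-- `ψ(ω) = P₁(ω)* ψ_S`. -/
def psiOf {d : ℕ} (ψS : Evec d) (A : Op d) : Evec d := adjoint (cesaroProj A) ψS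

/-- `Q(ω) = 1 - |ψ_S⟩⟨ψ(ω)|`. -/
def Qof {d : ℕ} (ψS : Evec d) (A : Op d) : Op d := 1 - ketBra ψS (psiOf ψS A)

/-- `M_Q(ω) = Q(ω) M(ω) Q(ω)`. -/
def MQof {d : ℕ} (ψS : Evec d) (A : Op d) : Op d := Qof ψS A * A * Qof ψS A


/-- Mean ergodic theorem: in a finite-dimensional algebra, a power-bounded element `T` has Cesàro averages
converging to some `P` with `T P = P` and `1 - P = (1 - T) R` for some `R`. -/
lemma exists_cesaro_limit {𝔸 : Type*} [NormedRing 𝔸] [NormedAlgebra ℂ 𝔸] [FiniteDimensional ℂ 𝔸]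
    (T : 𝔸) {K : ℝ} (hT : ∀ k, ‖T ^ k‖ ≤ K) :
    ∃ P R : 𝔸, T * P = P ∧ 1 - P = (1 - T) * R ∧
      Tendsto (fun N : ℕ => (N : ℂ)⁻¹ • ∑ k ∈ Finset.range N, T ^ k) atTop (nhds P) := by
  have : ProperSpace 𝔸 := FiniteDimensional.proper ℂ 𝔸
  set C : ℕ → 𝔸 := fun N => (N : ℂ)⁻¹ • ∑ k ∈ Finset.range N, T ^ k with hC
  have hK : 0 ≤ K := (norm_nonneg _).trans (hT 0)
  have hCbd : ∀ N, ‖C N‖ ≤ K := by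
    intro N
    rw [hC, norm_smul, norm_inv, Complex.norm_natCast]
    rcases Nat.eq_zero_or_pos N with rfl | hN
    · simpa using hK
    · rw [inv_mul_eq_div, div_le_iff₀ (by positivity)]
      calc ‖∑ k ∈ Finset.range N, T ^ k‖ ≤ ∑ k ∈ Finset.range N, ‖T ^ k‖ := norm_sum_le _ _
        _ ≤ ∑ k ∈ Finset.range N, K := Finset.sum_le_sum fun k _ => hT k
        _ = K * N := by simp [mul_comm]
  have hinv : Tendsto (fun N : ℕ => (N : ℂ)⁻¹) atTop (nhds 0) :=
    tendsto_inv_atTop_nhds_zero_nat (𝕜 := ℂ)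
  have hzero : Tendsto (fun N => C N * (1 - T)) atTop (nhds 0) := by
    have h1 : ∀ N, C N * (1 - T) = (N : ℂ)⁻¹ • (1 - T ^ N) := by
      intro N
      rw [hC, smul_mul_assoc, geom_sum_mul_neg]
    simp_rw [h1]
    have hbdd : IsBoundedUnder (· ≤ ·) atTop (fun N => ‖(1 : 𝔸) - T ^ N‖) :=
      isBoundedUnder_of ⟨K + K, fun N => (norm_sub_le _ _).trans
        (add_le_add (by simpa using hT 0) (hT N))⟩
    exact NormedField.tendsto_zero_smul_of_tendsto_zero_of_bounded hinv hbdd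
  have hcomm : ∀ N, Commute (C N) (1 - T) := fun N =>
    ((Commute.sum_left _ _ _ fun k _ =>
      (Commute.one_right _).sub_right ((Commute.refl T).pow_left k))).smul_left _
  obtain ⟨P, -, φ, hφ, hP⟩ := tendsto_subseq_of_bounded
    (Metric.isBounded_closedBall (x := (0 : 𝔸)) (r := K)) (x := C) fun N => by
      simpa using hCbd N
  have hTP : (1 - T) * P = 0 := by
    refine tendsto_nhds_unique (f := fun n => (1 - T) * C (φ n)) (hP.const_mul _) ?_
    simpa only [← (hcomm _).eq, Function.comp_def] using hzero.comp hφ.tendsto_atTop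
  have hTP' : T * P = P := by
    rw [sub_mul, one_mul, sub_eq_zero] at hTP
    exact hTP.symm
  have hrange : ∃ R : 𝔸, (1 - T) * R = 1 - P := by
    have hcl : IsClosed ((LinearMap.range (LinearMap.mulLeft ℂ (1 - T)) : Submodule ℂ (𝔸)) :
        Set (𝔸)) := Submodule.closed_of_finiteDimensional _
    have hmem : ∀ᶠ n in atTop, 1 - C (φ n) ∈
        ((LinearMap.range (LinearMap.mulLeft ℂ (1 - T)) : Submodule ℂ (𝔸)) : Set (𝔸)) := by
      filter_upwards [hφ.tendsto_atTop.eventually (eventually_gt_atTop 0)] with n hn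
      have h1 : (1 : 𝔸) - C (φ n)
          = ((φ n : ℕ) : ℂ)⁻¹ • ∑ k ∈ Finset.range (φ n), (1 - T ^ k) := by
        have : ((φ n : ℕ) : ℂ) ≠ 0 := by exact_mod_cast hn.ne'
        rw [Finset.sum_sub_distrib, smul_sub]
        simp only [Finset.sum_const, Finset.card_range, ← Nat.cast_smul_eq_nsmul ℂ, smul_smul,
          inv_mul_cancel₀ this, one_smul, hC]
      rw [h1]
      refine Submodule.smul_mem _ _ (Submodule.sum_mem _ fun k _ => ?_)
      exact ⟨∑ i ∈ Finset.range k, T ^ i, by rw [LinearMap.mulLeft_apply, mul_neg_geom_sum]⟩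
    exact hcl.mem_of_tendsto (tendsto_const_nhds.sub hP) hmem
  obtain ⟨R, hR⟩ := hrange
  refine ⟨P, R, hTP', hR.symm, ?_⟩
  have hCP : ∀ᶠ N in atTop, P + C N * (1 - T) * R = C N := by
    filter_upwards [eventually_gt_atTop 0] with N hN
    have hkP : ∀ k, T ^ k * P = P := by
      intro k
      induction k with
      | zero => simp
      | succ k ih => rw [pow_succ, mul_assoc, hTP', ih]
    have hN' : (N : ℂ) ≠ 0 := by exact_mod_cast hN.ne'
    have h2 : C N * P = P := by
      simp only [hC, smul_mul_assoc, Finset.sum_mul, hkP, Finset.sum_const, Finset.card_range,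
        ← Nat.cast_smul_eq_nsmul ℂ, smul_smul, inv_mul_cancel₀ hN', one_smul]
    rw [mul_assoc, hR, mul_sub, mul_one, h2]
    abel
  refine Tendsto.congr' hCP ?_
  simpa using (hzero.mul_const R).const_add P

section

variable {d : ℕ}

lemma exists_norm_le_mul_seminorm (Nrm : Seminorm ℂ (Evec d)) (hNrm : ∀ x, Nrm x = 0 → x = 0) :
    ∃ K : ℝ, 0 < K ∧ ∀ x, ‖x‖ ≤ K * Nrm x := by
  have hcont : Continuous Nrm := (Nrm.convexOn.locallyLipschitz).continuous
  rcases (Metric.sphere (0 : Evec d) 1).eq_empty_or_nonempty with he | hne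
  · refine ⟨1, one_pos, fun x => ?_⟩
    by_cases hx : x = 0
    · simp [hx]
    · have : ((‖x‖ : ℂ)⁻¹ • x) ∈ Metric.sphere (0 : Evec d) 1 := by
        simp [norm_smul, hx]
      simp [he] at this
  · obtain ⟨z, hz, hmin⟩ := (isCompact_sphere (0 : Evec d) 1).exists_isMinOn hne hcont.continuousOn
    have hz0 : z ≠ 0 := by
      rintro rfl
      simp at hz
    have hpos : 0 < Nrm z := lt_of_le_of_ne (apply_nonneg _ _) fun h => hz0 (hNrm z h.symm)
    refine ⟨(Nrm z)⁻¹, inv_pos.2 hpos, fun x => ?_⟩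
    by_cases hx : x = 0
    · simp [hx]
    · have h1 : ((‖x‖ : ℂ)⁻¹ • x) ∈ Metric.sphere (0 : Evec d) 1 := by
        simp [norm_smul, hx]
      have h2 : Nrm z ≤ Nrm ((‖x‖ : ℂ)⁻¹ • x) := hmin h1
      rw [map_smul_eq_mul, norm_inv, Complex.norm_real, norm_norm, inv_mul_eq_div,
        le_div_iff₀ (norm_pos_iff.2 hx)] at h2
      rw [inv_mul_eq_div, le_div_iff₀ hpos]
      linarith

/-- The operators that are contractions for a given seminorm. -/
def contractionSet (Nrm : Seminorm ℂ (Evec d)) : Submonoid (Op d) where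
  carrier := {A | ∀ x, Nrm (A x) ≤ Nrm x}
  one_mem' := fun _ => le_rfl
  mul_mem' := fun {_ B} hA hB x => (hA (B x)).trans (hB x)

lemma exists_norm_le_of_mem_contractionSet (Nrm : Seminorm ℂ (Evec d))
    (hNrm : ∀ x, Nrm x = 0 → x = 0) : ∃ K : ℝ, ∀ A ∈ contractionSet Nrm, ‖A‖ ≤ K := by
  obtain ⟨K, hK, hle⟩ := exists_norm_le_mul_seminorm Nrm hNrm
  have hcont : Continuous Nrm := (Nrm.convexOn.locallyLipschitz).continuous
  obtain ⟨C, hC, hbd⟩ := Seminorm.bound_of_continuous_normedSpace Nrm hcont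
  refine ⟨K * C, fun A hA => ContinuousLinearMap.opNorm_le_bound _ (by positivity) fun x => ?_⟩
  calc ‖A x‖ ≤ K * Nrm (A x) := hle _
    _ ≤ K * (C * ‖x‖) := by gcongr; exact (hA x).trans (hbd x)
    _ = _ := by ring

lemma convex_contractionSet (Nrm : Seminorm ℂ (Evec d)) :
    Convex ℝ (contractionSet Nrm : Set (Op d)) := by
  intro A hA B hB a b ha hb hab x
  have hs : ∀ (t : ℝ) (_ : 0 ≤ t) (y : Evec d), Nrm (t • y) = t * Nrm y := by
    intro t ht y
    rw [← Complex.coe_smul, map_smul_eq_mul, Complex.norm_real, Real.norm_of_nonneg ht]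
  calc Nrm ((a • A + b • B) x) = Nrm (a • A x + b • B x) := rfl
    _ ≤ Nrm (a • A x) + Nrm (b • B x) := map_add_le_add _ _ _
    _ = a * Nrm (A x) + b * Nrm (B x) := by rw [hs a ha, hs b hb]
    _ ≤ a * Nrm x + b * Nrm x := by gcongr; exacts [hA x, hB x]
    _ = Nrm x := by rw [← add_mul, hab, one_mul]

lemma isClosed_contractionSet (Nrm : Seminorm ℂ (Evec d)) :
    IsClosed (contractionSet Nrm : Set (Op d)) := by
  have hcont : Continuous Nrm := (Nrm.convexOn.locallyLipschitz).continuous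
  have : (contractionSet Nrm : Set (Op d)) = ⋂ x, {A : Op d | Nrm (A x) ≤ Nrm x} := by
    ext A
    simp only [Set.mem_iInter, Set.mem_ofPred_eq]
    rfl
  rw [this]
  exact isClosed_iInter fun x =>
    isClosed_le (hcont.comp (ContinuousLinearMap.apply ℂ (Evec d) x).continuous) continuous_const

lemma mem_span_of_mcalE {ψS : Evec d} (hψS : ‖ψS‖ = 1) {A : Op d} (hA : mcalE ψS A)
    {x : Evec d} (hx : A x = x) : ∃ c : ℂ, x = c • ψS := by
  obtain ⟨-, hfix, -, hrank⟩ := hA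
  have hψ0 : ψS ≠ 0 := by
    rintro rfl
    simp at hψS
  have hmem : ∀ y, A y = y →
      y ∈ Module.End.maxGenEigenspace (A : Evec d →ₗ[ℂ] Evec d) 1 := by
    intro y hy
    refine Module.End.mem_maxGenEigenspace _ _ _ |>.2 ⟨1, ?_⟩
    simp [hy]
  obtain ⟨c, hc⟩ := (finrank_eq_one_iff_of_nonzero'
    (⟨ψS, hmem _ hfix⟩ : Module.End.maxGenEigenspace (A : Evec d →ₗ[ℂ] Evec d) 1)
    (by simpa [Subtype.ext_iff] using hψ0)).1 hrank ⟨x, hmem x hx⟩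
  exact ⟨c, by simpa using (congrArg Subtype.val hc).symm⟩

lemma integrable_of_mem_contractionSet {Ω : Type*} [MeasurableSpace Ω] (p : Measure Ω)
    [IsProbabilityMeasure p] {M : Ω → Op d} (hM : Measurable M) (Nrm : Seminorm ℂ (Evec d))
    (hNrm : ∀ x, Nrm x = 0 → x = 0) (hcontr : ∀ ω, M ω ∈ contractionSet Nrm) :
    Integrable M p := by
  have : ProperSpace (Op d) := FiniteDimensional.proper ℂ (Op d)
  obtain ⟨K, hK⟩ := exists_norm_le_of_mem_contractionSet Nrm hNrm
  exact Integrable.of_bound hM.aestronglyMeasurable K (ae_of_all _ fun ω => hK _ (hcontr ω))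

/-- If `x` is not a multiple of `ψS`, some functional dominated by `Nrm` kills `ψS` and has maximal,
positive real part at `x`. -/
lemma exists_maximal_functional (Nrm : Seminorm ℂ (Evec d)) (hNrm : ∀ x, Nrm x = 0 → x = 0)
    {ψS : Evec d} (hψS : ‖ψS‖ = 1) {x : Evec d} (hx : ∀ c : ℂ, x ≠ c • ψS) :
    ∃ f : Evec d →L[ℂ] ℂ, (f ψS = 0 ∧ ∀ y, ‖f y‖ ≤ Nrm y) ∧ 0 < (f x).re ∧
      ∀ g : Evec d →L[ℂ] ℂ, (g ψS = 0 ∧ ∀ y, ‖g y‖ ≤ Nrm y) → (g x).re ≤ (f x).re := by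
  have : ProperSpace (Evec d →L[ℂ] ℂ) := FiniteDimensional.proper ℂ _
  have hcont : Continuous Nrm := (Nrm.convexOn.locallyLipschitz).continuous
  set S : Set (Evec d →L[ℂ] ℂ) := {g | g ψS = 0 ∧ ∀ y, ‖g y‖ ≤ Nrm y} with hS
  have hev : ∀ y, Continuous fun g : Evec d →L[ℂ] ℂ => g y := fun y =>
    (ContinuousLinearMap.apply ℂ ℂ y).continuous
  have hclosed : IsClosed S := by
    have hdom : IsClosed {g : Evec d →L[ℂ] ℂ | ∀ y, ‖g y‖ ≤ Nrm y} := by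
      simp only [Set.ofPred_forall]
      exact isClosed_iInter fun y => isClosed_le (hev y).norm continuous_const
    exact (isClosed_eq (hev ψS) continuous_const).inter hdom
  obtain ⟨C, hC, hbd⟩ := Seminorm.bound_of_continuous_normedSpace Nrm hcont
  have hcompact : IsCompact S := by
    refine Metric.isCompact_of_isClosed_isBounded hclosed
      ((Metric.isBounded_closedBall (x := 0) (r := C)).subset fun g hg => ?_)
    rw [mem_closedBall_zero_iff]
    exact ContinuousLinearMap.opNorm_le_bound _ hC.le fun y => (hg.2 y).trans (hbd y)
  obtain ⟨f, hf, hmax⟩ := hcompact.exists_isMaxOn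
    ⟨0, by simp [hS]⟩ ((Complex.continuous_re.comp (hev x)).continuousOn)
  refine ⟨f, hf, ?_, fun g hg => hmax hg⟩
  obtain ⟨K, hK, hle⟩ := exists_norm_le_mul_seminorm Nrm hNrm
  set z : Evec d := x - inner ℂ ψS x • ψS with hz
  have hz0 : z ≠ 0 := sub_ne_zero.2 (hx _)
  have hzψ : inner ℂ z ψS = 0 := by
    simp [hz, inner_self_eq_norm_sq_to_K, hψS]
  have hzx : inner ℂ z x = ((‖z‖ ^ 2 : ℝ) : ℂ) := by
    have h1 : x = z + inner ℂ ψS x • ψS := by simp [hz]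
    rw [h1, inner_add_right, inner_smul_right, hzψ, inner_self_eq_norm_sq_to_K]
    simp
  have hzpos : 0 < ‖z‖ := norm_pos_iff.2 hz0
  have ht : 0 < (‖z‖ * K)⁻¹ := by positivity
  have hg : (((‖z‖ * K)⁻¹ : ℝ) : ℂ) • innerSL ℂ z ∈ S := by
    refine ⟨by simp [hzψ], fun y => ?_⟩
    rw [smul_apply, innerSL_apply_apply, norm_smul, Complex.norm_real,
      Real.norm_of_nonneg ht.le, inv_mul_eq_div, div_le_iff₀ (by positivity)]
    calc ‖inner ℂ z y‖ ≤ ‖z‖ * ‖y‖ := norm_inner_le_norm _ _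
      _ ≤ ‖z‖ * (K * Nrm y) := by gcongr; exact hle y
      _ = _ := by ring
  have hgx := hmax hg
  refine lt_of_lt_of_le ?_ hgx
  simp only [Function.comp_apply, smul_apply, innerSL_apply_apply, hzx,
    smul_eq_mul, ← Complex.ofReal_mul, Complex.ofReal_re]
  positivity

/-- The mean of the random contractions has only the multiples of `ψS` as fixed points. -/
lemma mem_span_of_integral_apply_eq {Ω : Type*} [MeasurableSpace Ω]
    (p : Measure Ω) [IsProbabilityMeasure p]
    (M : Ω → Op d) (hM : Integrable M p)
    (Nrm : Seminorm ℂ (Evec d)) (hNrm : ∀ x, Nrm x = 0 → x = 0)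
    (hcontr : ∀ ω, M ω ∈ contractionSet Nrm)
    {ψS : Evec d} (hψS : ‖ψS‖ = 1) (hfix : ∀ ω, M ω ψS = ψS)
    (hpos : 0 < p {ω | mcalE ψS (M ω)}) {x : Evec d} (hx : (∫ ω, M ω ∂p) x = x) :
    ∃ c : ℂ, x = c • ψS := by
  by_contra! hne
  obtain ⟨f₀, hf₀, hf₀pos, hf₀max⟩ := exists_maximal_functional Nrm hNrm hψS hne
  set F : Set (Evec d →L[ℂ] ℂ) :=
    {f | (f ψS = 0 ∧ ∀ y, ‖f y‖ ≤ Nrm y) ∧ (f x).re = (f₀ x).re} with hF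
  have hae : ∀ f ∈ F, ∀ᵐ ω ∂p, (f (M ω x)).re = (f₀ x).re := by
    intro f hf
    set L : Op d →L[ℝ] ℝ := Complex.reCLM ∘L
      (f ∘L ContinuousLinearMap.apply ℂ (Evec d) x).restrictScalars ℝ with hL
    have hLM : ∀ A : Op d, L A = (f (A x)).re := fun A => rfl
    have hint : ∫ ω, L (M ω) ∂p = ∫ _, (f₀ x).re ∂p := by
      rw [L.integral_comp_comm hM, hLM, hx, hf.2]
      simp
    have hle : ∀ ω, L (M ω) ≤ (f₀ x).re := fun ω =>
      hf₀max (f ∘L M ω) ⟨by simp [hfix, hf.1.1], fun y => (hf.1.2 _).trans (hcontr ω y)⟩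
    exact (integral_eq_iff_of_ae_le (L.integrable_comp hM) (integrable_const _)
      (ae_of_all _ hle)).1 hint
  have : ProperSpace (Evec d →L[ℂ] ℂ) := FiniteDimensional.proper ℂ _
  obtain ⟨D, hDc, hDd⟩ := TopologicalSpace.exists_countable_dense F
  have haeF : ∀ᵐ ω ∂p, ∀ f : F, (f.1 (M ω x)).re = (f₀ x).re := by
    filter_upwards [(ae_ball_iff hDc).2 fun f (_ : f ∈ D) => hae f.1 f.2] with ω hω
    have hc : Continuous fun f : F => (f.1 (M ω x)).re := Complex.continuous_re.comp
      ((ContinuousLinearMap.apply ℂ ℂ (M ω x)).continuous.comp continuous_subtype_val)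
    exact fun f => congrFun (hc.ext_on hDd continuous_const fun f hf => hω f hf) f
  obtain ⟨ω, hω, hωF⟩ := ((frequently_ae_iff.2 hpos.ne').and_eventually haeF).exists
  have hstab : ∀ f ∈ F, f ∘L M ω ∈ F := fun f hf =>
    ⟨⟨by simp [hfix, hf.1.1], fun y => (hf.1.2 _).trans (hcontr ω y)⟩, hωF ⟨f, hf⟩⟩
  have hiter : ∀ k : ℕ, f₀ ∘L (M ω ^ k) ∈ F := by
    intro k
    induction k with
    | zero => exact ⟨hf₀, rfl⟩
    | succ k ih => exact hstab _ ih
  obtain ⟨K, hK⟩ := exists_norm_le_of_mem_contractionSet Nrm hNrm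
  obtain ⟨P, -, hP, -, hlim⟩ := exists_cesaro_limit (M ω)
    fun k => hK _ (pow_mem (hcontr ω) k)
  obtain ⟨c, hc⟩ := mem_span_of_mcalE hψS hω (x := P x) (DFunLike.congr_fun hP x)
  have hlim' := (((Complex.continuous_re.comp f₀.continuous).comp
    (ContinuousLinearMap.apply ℂ (Evec d) x).continuous).tendsto P).comp hlim
  have hconst : ∀ᶠ N in atTop, ((fun A : Op d => (f₀ (A x)).re) ∘
      fun N : ℕ => (N : ℂ)⁻¹ • ∑ k ∈ Finset.range N, M ω ^ k) N = (f₀ x).re := by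
    filter_upwards [eventually_gt_atTop 0] with N hN
    have hN' : (N : ℝ) ≠ 0 := by exact_mod_cast hN.ne'
    have hk : ∀ k, (f₀ ((M ω ^ k) x)).re = (f₀ x).re := fun k => (hiter k).2
    have hcast : ((N : ℂ)⁻¹) = (((N : ℝ)⁻¹ : ℝ) : ℂ) := by simp
    simp only [Function.comp_apply, smul_apply,
      sum_apply, map_smul, map_sum, smul_eq_mul, hcast, Complex.re_ofReal_mul,
      Complex.re_sum, hk, Finset.sum_const, Finset.card_range, nsmul_eq_mul]
    field_simp
  have heq := tendsto_nhds_unique_of_eventuallyEq hlim' tendsto_const_nhds hconst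
  have h0 : f₀ (P x) = 0 := by rw [hc, map_smul, hf₀.1, smul_zero]
  have h1 : (f₀ (P x)).re = (f₀ x).re := heq
  rw [h0, Complex.zero_re] at h1
  exact hf₀pos.ne h1

end

/-- Strong law of large numbers for uniformly bounded, pairwise orthogonal random variables. -/
lemma ae_tendsto_average_of_orthogonal {Ω : Type*} [MeasurableSpace Ω] (μ : Measure Ω)
    [IsProbabilityMeasure μ] (X : ℕ → Ω → ℝ) (hX : ∀ n, AEStronglyMeasurable (X n) μ) {C : ℝ}
    (hC : ∀ n ω, |X n ω| ≤ C) (horth : ∀ m n, m < n → ∫ ω, X m ω * X n ω ∂μ = 0) :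
    ∀ᵐ ω ∂μ, Tendsto (fun N : ℕ => (∑ n ∈ Finset.range N, X n ω) / N) atTop (nhds 0) := by
  set S : ℕ → Ω → ℝ := fun N ω => ∑ n ∈ Finset.range N, X n ω with hS
  have hint : ∀ n, Integrable (X n) μ := fun n =>
    Integrable.of_bound (hX n) C (ae_of_all _ fun ω => hC n ω)
  have hint2 : ∀ m n, Integrable (fun ω => X m ω * X n ω) μ := fun m n =>
    (hint n).bdd_mul (hX m) (ae_of_all _ fun ω => hC m ω)
  have horth' : ∀ m n, m ≠ n → ∫ ω, X m ω * X n ω ∂μ = 0 := by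
    intro m n hmn
    rcases lt_or_gt_of_ne hmn with h | h
    · exact horth m n h
    · simpa only [mul_comm] using horth n m h
  have hSsq : ∀ N ω, S N ω ^ 2
      = ∑ i ∈ Finset.range N, ∑ j ∈ Finset.range N, X i ω * X j ω := fun N ω => by
    rw [sq, hS, Finset.sum_mul_sum]
  have hSint : ∀ N, Integrable (fun ω => S N ω ^ 2) μ := fun N => by
    simp only [hSsq]
    exact integrable_finsetSum _ fun i _ => integrable_finsetSum _ fun j _ => hint2 i j
  have hvar : ∀ N, ∫ ω, S N ω ^ 2 ∂μ ≤ N * C ^ 2 := by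
    intro N
    simp only [hSsq]
    rw [integral_finsetSum _ fun i _ => integrable_finsetSum _ fun j _ => hint2 i j]
    simp only [integral_finsetSum _ fun j _ => hint2 _ j]
    calc ∑ i ∈ Finset.range N, ∑ j ∈ Finset.range N, ∫ ω, X i ω * X j ω ∂μ
        = ∑ i ∈ Finset.range N, ∫ ω, X i ω * X i ω ∂μ := by
          refine Finset.sum_congr rfl fun i hi => ?_
          exact Finset.sum_eq_single i (fun j _ hj => horth' i j hj.symm) fun h => (h hi).elim
      _ ≤ ∑ i ∈ Finset.range N, C ^ 2 := by
          refine Finset.sum_le_sum fun i _ => ?_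
          calc ∫ ω, X i ω * X i ω ∂μ ≤ ∫ _, C ^ 2 ∂μ := by
                refine integral_mono (hint2 i i) (integrable_const _) fun ω => ?_
                change X i ω * X i ω ≤ C ^ 2
                rw [← sq, ← sq_abs]
                exact pow_le_pow_left₀ (abs_nonneg _) (hC i ω) 2
            _ = C ^ 2 := by simp
      _ = N * C ^ 2 := by simp
  have hsub : ∀ᵐ ω ∂μ, Tendsto (fun k : ℕ => S ((k + 1) ^ 2) ω / ((k + 1) ^ 2 : ℕ)) atTop
      (nhds 0) := by
    have hnn : ∀ (k : ℕ) (ω : Ω), 0 ≤ (S ((k + 1) ^ 2) ω / ((k + 1) ^ 2 : ℕ)) ^ 2 :=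
      fun k ω => sq_nonneg _
    have hkint : ∀ k : ℕ, Integrable (fun ω => (S ((k + 1) ^ 2) ω / ((k + 1) ^ 2 : ℕ)) ^ 2) μ := by
      intro k
      simp only [div_pow]
      exact (hSint _).div_const _
    have hkle : ∀ k : ℕ, ∫ ω, (S ((k + 1) ^ 2) ω / ((k + 1) ^ 2 : ℕ)) ^ 2 ∂μ
        ≤ C ^ 2 * (1 / ((k + 1 : ℕ) : ℝ) ^ 2) := by
      intro k
      simp only [div_pow, integral_div]
      have hk : (0 : ℝ) < ((k + 1 : ℕ) : ℝ) := by positivity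
      rw [div_le_iff₀ (by positivity)]
      refine (hvar _).trans (le_of_eq ?_)
      push_cast at hk ⊢
      field_simp
    have hsum : Summable fun k : ℕ => C ^ 2 * (1 / ((k + 1 : ℕ) : ℝ) ^ 2) :=
      ((summable_nat_add_iff 1).2 (Real.summable_one_div_nat_pow.2 one_lt_two)).mul_left _
    have hlint : ∫⁻ ω, ∑' k : ℕ, ENNReal.ofReal ((S ((k + 1) ^ 2) ω / ((k + 1) ^ 2 : ℕ)) ^ 2) ∂μ
        ≠ ⊤ := by
      rw [lintegral_tsum fun k => (hkint k).aestronglyMeasurable.aemeasurable.ennreal_ofReal]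
      simp only [← ofReal_integral_eq_lintegral_ofReal (hkint _) (ae_of_all _ (hnn _))]
      refine ne_top_of_le_ne_top ?_
        (ENNReal.tsum_le_tsum fun k => ENNReal.ofReal_le_ofReal (hkle k))
      exact hsum.tsum_ofReal_ne_top
    filter_upwards [ae_lt_top' (AEMeasurable.tsum fun k =>
      (hkint k).aestronglyMeasurable.aemeasurable.ennreal_ofReal) hlint] with ω hω
    have h0 := ENNReal.tendsto_atTop_zero_of_tsum_ne_top hω.ne
    have h1 : Tendsto (fun k : ℕ => (S ((k + 1) ^ 2) ω / ((k + 1) ^ 2 : ℕ)) ^ 2) atTop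
        (nhds 0) := by
      have := (ENNReal.tendsto_toReal ENNReal.zero_ne_top).comp h0
      simpa only [Function.comp_def, ENNReal.toReal_ofReal (hnn _ _), ENNReal.toReal_zero] using this
    have h2 := h1.sqrt
    simp only [Real.sqrt_sq_eq_abs, Real.sqrt_zero] at h2
    exact (tendsto_zero_iff_abs_tendsto_zero _).2 h2
  filter_upwards [hsub] with ω hω
  have hmono : Monotone fun N : ℕ => S N ω + C * N := by
    refine monotone_nat_of_le_succ fun N => ?_
    have := neg_abs_le (X N ω)
    have := hC N ω
    simp only [hS, Finset.sum_range_succ]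
    push_cast
    linarith
  have hlim := tendsto_div_of_monotone_of_exists_subseq_tendsto_div
    (fun N : ℕ => S N ω + C * N) C hmono fun a ha => by
      refine ⟨fun k => (k + 1) ^ 2, ?_, ?_, ?_⟩
      · have hr : Tendsto (fun k : ℕ => (1 + 1 / ((k : ℝ) + 1)) ^ 2) atTop (nhds 1) := by
          simpa using ((tendsto_one_div_add_atTop_nhds_zero_nat (𝕜 := ℝ)).const_add 1).pow 2
        filter_upwards [hr.eventually_lt_const ha] with k hk
        have hk0 : (0 : ℝ) < (k : ℝ) + 1 := by positivity
        calc (((k + 1 + 1) ^ 2 : ℕ) : ℝ) = (1 + 1 / ((k : ℝ) + 1)) ^ 2 * ((k + 1) ^ 2 : ℕ) := by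
              push_cast
              field_simp
          _ ≤ a * ((k + 1) ^ 2 : ℕ) := by gcongr
      · exact (tendsto_pow_atTop two_ne_zero).comp (tendsto_add_atTop_nat 1)
      · have : ∀ k : ℕ, (S ((k + 1) ^ 2) ω + C * ((k + 1) ^ 2 : ℕ)) / ((k + 1) ^ 2 : ℕ)
            = S ((k + 1) ^ 2) ω / ((k + 1) ^ 2 : ℕ) + C := by
          intro k
          have hk : (((k + 1) ^ 2 : ℕ) : ℝ) ≠ 0 := by positivity
          rw [add_div, mul_div_cancel_right₀ _ hk]
        simp only [this]
        simpa using hω.add_const C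
  have hlim2 := hlim.sub_const C
  rw [sub_self] at hlim2
  refine hlim2.congr' ?_
  filter_upwards [eventually_gt_atTop 0] with N hN
  have hN' : (N : ℝ) ≠ 0 := by exact_mod_cast hN.ne'
  rw [add_div, mul_div_cancel_right₀ _ hN', add_sub_cancel_right]

lemma map_past_present_eq_prod {Ω : Type*} [MeasurableSpace Ω] {p : Measure Ω}
    [IsProbabilityMeasure p] {Pb : Measure (ℕ → Ω)}
    (hPb : ∀ n : ℕ, Pb.map (fun ωb (i : Fin n) => ωb i) = Measure.pi fun _ : Fin n => p) (n : ℕ) :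
    Pb.map (fun ωb => ((fun i : Fin n => ωb i), ωb n))
      = (Measure.pi fun _ : Fin n => p).prod p := by
  have h1 := measurePreserving_piFinSuccAbove (fun _ : Fin (n + 1) => p) (Fin.last n)
  have h2 : MeasurePreserving (fun ωb : ℕ → Ω => fun i : Fin (n + 1) => ωb i) Pb
      (Measure.pi fun _ : Fin (n + 1) => p) :=
    ⟨by fun_prop, hPb (n + 1)⟩
  have h3 := (Measure.measurePreserving_swap (μ := p) (ν := Measure.pi fun _ : Fin n => p)).comp
    (h1.comp h2)
  convert h3.map_eq using 2
  ext ωb i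
  · simp [MeasurableEquiv.piFinSuccAbove, Fin.init]
  · simp [MeasurableEquiv.piFinSuccAbove]

lemma tendsto_zero_of_coord {ι E : Type*} [Fintype ι] [NormedAddCommGroup E] [NormedSpace ℝ E]
    (b : Module.Basis ι ℝ E) {u : ℕ → E}
    (h : ∀ i, Tendsto (fun N => b.coord i (u N)) atTop (nhds 0)) : Tendsto u atTop (nhds 0) := by
  have hlim := tendsto_finsetSum Finset.univ fun i (_ : i ∈ Finset.univ) =>
    (h i).smul_const (b i)
  simp only [zero_smul, Finset.sum_const_zero] at hlim
  exact hlim.congr fun N => b.sum_repr (u N)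

section

variable {d : ℕ} {Ω : Type*}

/-- The product `M (v 0) * ⋯ * M (v (n - 1))`. -/
def wordProd (M : Ω → Op d) {n : ℕ} (v : Fin n → Ω) : Op d := (List.ofFn fun i => M (v i)).prod

lemma wordProd_succ (M : Ω → Op d) {n : ℕ} (v : Fin (n + 1) → Ω) :
    wordProd M v = wordProd M (fun i : Fin n => v i.castSucc) * M (v (Fin.last n)) := by
  rw [wordProd, List.ofFn_succ', List.prod_concat]
  rfl

lemma measurable_wordProd [MeasurableSpace Ω] {M : Ω → Op d} (hM : Measurable M) (n : ℕ) :
    Measurable fun v : Fin n → Ω => wordProd M v := by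
  have : ProperSpace (Op d) := FiniteDimensional.proper ℂ (Op d)
  induction n with
  | zero => simp [wordProd]
  | succ n ih =>
    simp only [wordProd_succ]
    exact (ih.comp (by fun_prop : Measurable fun (v : Fin (n + 1) → Ω) (i : Fin n) =>
      v i.castSucc)).mul (hM.comp (measurable_pi_apply _))

lemma wordProd_mem {M : Ω → Op d} {S : Submonoid (Op d)} (h : ∀ ω, M ω ∈ S) {n : ℕ}
    (v : Fin n → Ω) : wordProd M v ∈ S := by
  refine Submonoid.list_prod_mem _ fun A hA => ?_
  obtain ⟨i, rfl⟩ := (List.mem_ofFn' _ _).1 hA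
  exact h _

/-- The martingale increments of the random products have averages converging to `0`. -/
lemma ae_tendsto_average_increments [MeasurableSpace Ω] (p : Measure Ω) [IsProbabilityMeasure p]
    {M : Ω → Op d} (hM : Measurable M)
    (Nrm : Seminorm ℂ (Evec d)) (hNrm : ∀ x, Nrm x = 0 → x = 0)
    (hcontr : ∀ ω, M ω ∈ contractionSet Nrm)
    (Pb : Measure (ℕ → Ω)) [IsProbabilityMeasure Pb]
    (hPb : ∀ n : ℕ, Pb.map (fun ωb (i : Fin n) => ωb i) = Measure.pi fun _ : Fin n => p) :
    ∀ᵐ ωb ∂Pb, Tendsto (fun N : ℕ => (N : ℝ)⁻¹ • ∑ n ∈ Finset.range N,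
      wordProd M (fun i : Fin n => ωb i) * (M (ωb n) - ∫ ω, M ω ∂p)) atTop (nhds 0) := by
  have : ProperSpace (Op d) := FiniteDimensional.proper ℂ (Op d)
  obtain ⟨K, hK⟩ := exists_norm_le_of_mem_contractionSet Nrm hNrm
  have hint := integrable_of_mem_contractionSet p hM Nrm hNrm hcontr
  set E := ∫ ω, M ω ∂p with hE
  have hK0 : 0 ≤ K := (norm_nonneg _).trans (hK 1 (one_mem _))
  have hscalar : ∀ L : Op d →L[ℝ] ℝ, ∀ᵐ ωb ∂Pb, Tendsto (fun N : ℕ =>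
      (∑ n ∈ Finset.range N, L (wordProd M (fun i : Fin n => ωb i) * (M (ωb n) - E))) / N)
      atTop (nhds 0) := by
    intro L
    have hbd : ∀ (n : ℕ) (v : Fin n → Ω) (ω : Ω),
        ‖L (wordProd M v * (M ω - E))‖ ≤ ‖L‖ * (K * (K + ‖E‖)) := by
      intro n v ω
      refine (L.le_opNorm _).trans ?_
      gcongr
      refine (norm_mul_le _ _).trans ?_
      gcongr
      · exact hK _ (wordProd_mem hcontr v)
      · exact (norm_sub_le _ _).trans (by gcongr; exact hK _ (hcontr ω))
    have hmeas : ∀ n : ℕ, Measurable fun q : (Fin n → Ω) × Ω =>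
        L (wordProd M q.1 * (M q.2 - E)) := fun n =>
      L.continuous.measurable.comp (((measurable_wordProd hM n).comp measurable_fst).mul
        ((hM.comp measurable_snd).sub_const E))
    have hpair : ∀ n : ℕ, Measurable fun ωb : ℕ → Ω => ((fun i : Fin n => ωb i), ωb n) :=
      fun n => by fun_prop
    refine ae_tendsto_average_of_orthogonal Pb
      (fun n ωb => L (wordProd M (fun i : Fin n => ωb i) * (M (ωb n) - E)))
      (fun n => ((hmeas n).comp (hpair n)).aestronglyMeasurable)
      (C := ‖L‖ * (K * (K + ‖E‖))) (fun n ωb => hbd n _ _) fun m n hmn => ?_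
    set Y : (Fin n → Ω) → ℝ := fun v =>
      L (wordProd M (fun i : Fin m => v ⟨i, i.2.trans hmn⟩) * (M (v ⟨m, hmn⟩) - E)) with hY
    have hproj : Measurable fun v : Fin n → Ω =>
        ((fun i : Fin m => v ⟨i, i.2.trans hmn⟩), v ⟨m, hmn⟩) := by fun_prop
    have hYmeas : Measurable Y := (hmeas m).comp hproj
    set H : (Fin n → Ω) × Ω → ℝ := fun q => Y q.1 * L (wordProd M q.1 * (M q.2 - E)) with hH
    have hHmeas : Measurable H := (hYmeas.comp measurable_fst).mul (hmeas n)
    have hHint : Integrable H ((Measure.pi fun _ : Fin n => p).prod p) := by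
      refine Integrable.of_bound hHmeas.aestronglyMeasurable
        ((‖L‖ * (K * (K + ‖E‖))) * (‖L‖ * (K * (K + ‖E‖)))) (ae_of_all _ fun q => ?_)
      rw [hH, norm_mul]
      exact mul_le_mul (hbd m _ _) (hbd n _ _) (norm_nonneg _) (by positivity)
    have hinner : ∀ v : Fin n → Ω, ∫ ω, H (v, ω) ∂p = 0 := by
      intro v
      set L' : Op d →L[ℝ] ℝ :=
        L ∘L (ContinuousLinearMap.mul ℂ (Op d) (wordProd M v)).restrictScalars ℝ with hL'
      have hL'E : ∫ ω, L' (M ω - E) ∂p = 0 := by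
        rw [L'.integral_comp_comm (φ := fun ω => M ω - E) (hint.sub (integrable_const _)),
          integral_sub hint (integrable_const _)]
        simp [hE]
      calc ∫ ω, H (v, ω) ∂p = ∫ ω, Y v * L' (M ω - E) ∂p := rfl
        _ = 0 := by rw [integral_const_mul, hL'E, mul_zero]
    calc ∫ ωb, _ ∂Pb = ∫ ωb, H ((fun i : Fin n => ωb i), ωb n) ∂Pb := rfl
      _ = ∫ q, H q ∂(Pb.map fun ωb => ((fun i : Fin n => ωb i), ωb n)) :=
        (integral_map (hpair n).aemeasurable hHmeas.aestronglyMeasurable).symm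
      _ = 0 := by
        rw [map_past_present_eq_prod hPb, integral_prod _ hHint]
        simp [hinner]
  have : FiniteDimensional ℝ (Op d) := FiniteDimensional.complexToReal _
  filter_upwards [ae_all_iff.2 fun i =>
    hscalar (LinearMap.toContinuousLinearMap ((Module.finBasis ℝ (Op d)).coord i))] with ωb hω
  refine tendsto_zero_of_coord (Module.finBasis ℝ (Op d)) fun i => (hω i).congr fun N => ?_
  rw [← map_sum, div_eq_inv_mul]
  exact (((Module.finBasis ℝ (Op d)).coord i).map_smul _ _).symm

end

lemma ketBra_adjoint_eq_self {d : ℕ} {ψS : Evec d} (hψS : ‖ψS‖ = 1) {P : Op d}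
    (hP : ∀ x, ∃ c : ℂ, P x = c • ψS) : ketBra ψS (adjoint P ψS) = P := by
  ext1 x
  obtain ⟨c, hc⟩ := hP x
  simp [ketBra, ContinuousLinearMap.adjoint_inner_left, hc, inner_smul_right,
    inner_self_eq_norm_sq_to_K, hψS]

lemma ofReal_inv_natCast_smul_op {d : ℕ} (N : ℕ) (A : Op d) : (N : ℝ)⁻¹ • A = (N : ℂ)⁻¹ • A := by
  ext x i
  simp

/-- If the averaged increments vanish, then the averaged products converge to the projection `P`
of the mean `E`. -/
lemma tendsto_average_of_increments {𝔸 : Type*} [NormedRing 𝔸] [NormedAlgebra ℂ 𝔸]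
    {Φ M : ℕ → 𝔸} {K : ℝ} (hΦ0 : Φ 0 = 1) (hsucc : ∀ n, Φ (n + 1) = Φ n * M n)
    (hK : ∀ n, ‖Φ n‖ ≤ K) {E P R : 𝔸} (hPR : 1 - P = (1 - E) * R) (hMP : ∀ n, M n * P = P)
    (hD : Tendsto (fun N : ℕ => (N : ℂ)⁻¹ • ∑ n ∈ Finset.range N, Φ n * (M n - E))
      atTop (nhds 0)) :
    Tendsto (fun N : ℕ => (N : ℂ)⁻¹ • ∑ n ∈ Finset.range N, Φ (n + 1)) atTop (nhds P) := by
  have hΦP : ∀ n, Φ n * P = P := by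
    intro n
    induction n with
    | zero => rw [hΦ0, one_mul]
    | succ n ih => rw [hsucc, mul_assoc, hMP, ih]
  have hbdry : Tendsto (fun N : ℕ => (N : ℂ)⁻¹ • ((Φ 0 - Φ N) * E)) atTop (nhds 0) := by
    refine NormedField.tendsto_zero_smul_of_tendsto_zero_of_bounded
      (tendsto_inv_atTop_nhds_zero_nat (𝕜 := ℂ))
      (isBoundedUnder_of ⟨(K + K) * ‖E‖, fun N => (norm_mul_le _ _).trans ?_⟩)
    gcongr
    exact (norm_sub_le _ _).trans (add_le_add (hK 0) (hK N))
  have htel : ∀ N : ℕ, (∑ n ∈ Finset.range N, Φ (n + 1)) * (1 - E)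
      = ∑ n ∈ Finset.range N, Φ n * (M n - E) + (Φ 0 - Φ N) * E := by
    intro N
    rw [← Finset.sum_range_sub' Φ N, Finset.sum_mul, Finset.sum_mul,
      ← Finset.sum_add_distrib]
    refine Finset.sum_congr rfl fun n _ => ?_
    rw [hsucc]
    noncomm_ring
  have hlim := (((hD.add hbdry).mul_const R).const_add P)
  simp only [add_zero, zero_mul] at hlim
  refine hlim.congr' ?_
  filter_upwards [eventually_gt_atTop 0] with N hN
  have hN' : (N : ℂ) ≠ 0 := by exact_mod_cast hN.ne'
  have hsumP : (N : ℂ)⁻¹ • ((∑ n ∈ Finset.range N, Φ (n + 1)) * P) = P := by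
    simp only [Finset.sum_mul, hΦP, Finset.sum_const, Finset.card_range,
      ← Nat.cast_smul_eq_nsmul ℂ, smul_smul, inv_mul_cancel₀ hN', one_smul]
  rw [← smul_add, ← htel, smul_mul_assoc, mul_assoc, ← hPR, mul_sub, mul_one, smul_sub, hsumP]
  abel

/-- Ergodic theorem for RRDP: almost surely
`(1/N) Σ_{n=1}^N M(ω_1) ⋯ M(ω_n) → |ψ_S⟩⟨θ| = P_{1,E[M]}`, with `θ = P_{1,E[M]}^* ψ_S`.
Here `ω̄ = (ω̄ 0, ω̄ 1, …)` stands for `(ω_1, ω_2, …)`. -/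
theorem stmt13 {d : ℕ} (hd : 1 ≤ d) {Ω : Type*} [MeasurableSpace Ω]
    (p : Measure Ω) [IsProbabilityMeasure p]
    (M : Ω → Op d) (hMmeas : Measurable M)
    (Nrm : Seminorm ℂ (Evec d)) (hNrm : ∀ x, Nrm x = 0 → x = 0)
    (hcontr : ∀ (ω : Ω) (x : Evec d), Nrm (M ω x) ≤ Nrm x)
    (ψS : Evec d) (hψS : ‖ψS‖ = 1) (hfix : ∀ ω, M ω ψS = ψS)
    (Pb : Measure (ℕ → Ω)) [IsProbabilityMeasure Pb]
    (hPb : ∀ n : ℕ, Pb.map (fun ωb (i : Fin n) => ωb i) = Measure.pi fun _ : Fin n => p)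
    (hpos : 0 < p {ω | mcalE ψS (M ω)}) :
    ∃ Ω₃ : Set (ℕ → Ω), Pb Ω₃ = 1 ∧
      (∀ ωb ∈ Ω₃,
        Tendsto
          (fun N : ℕ => (N : ℝ)⁻¹ •
            ∑ n ∈ Finset.range N, (List.ofFn fun i : Fin (n + 1) => M (ωb i)).prod)
          atTop (nhds (ketBra ψS (adjoint (cesaroProj (∫ ω, M ω ∂p)) ψS)))) ∧
      ketBra ψS (adjoint (cesaroProj (∫ ω, M ω ∂p)) ψS) = cesaroProj (∫ ω, M ω ∂p) := by
  have hmem : ∀ ω, M ω ∈ contractionSet Nrm := hcontr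
  obtain ⟨K, hK⟩ := exists_norm_le_of_mem_contractionSet Nrm hNrm
  have hint := integrable_of_mem_contractionSet p hMmeas Nrm hNrm hmem
  have hEmem : ∫ ω, M ω ∂p ∈ contractionSet Nrm :=
    (convex_contractionSet Nrm).integral_mem (isClosed_contractionSet Nrm) (ae_of_all _ hmem) hint
  obtain ⟨P, R, hEP, hPR, hlim⟩ := exists_cesaro_limit (∫ ω, M ω ∂p)
    fun k => hK _ (pow_mem hEmem k)
  have hPeq : cesaroProj (∫ ω, M ω ∂p) = P := hlim.limUnder_eq
  have hPspan : ∀ x, ∃ c : ℂ, P x = c • ψS := fun x =>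
    mem_span_of_integral_apply_eq p M hint Nrm hNrm hmem hψS hfix hpos (DFunLike.congr_fun hEP x)
  have hMP : ∀ ω, M ω * P = P := by
    intro ω
    ext1 x
    obtain ⟨c, hc⟩ := hPspan x
    change M ω (P x) = P x
    rw [hc, map_smul, hfix]
  have hket := ketBra_adjoint_eq_self hψS hPspan
  have hae := ae_tendsto_average_increments p hMmeas Nrm hNrm hmem Pb hPb
  refine ⟨_, (measure_congr (eventuallyEq_univ.2 hae)).trans measure_univ, fun ωb hω => ?_, ?_⟩
  · rw [hPeq, hket]
    have hω' : Tendsto _ _ _ := hω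
    simp only [ofReal_inv_natCast_smul_op] at hω' ⊢
    exact tendsto_average_of_increments (Φ := fun n => wordProd M fun i : Fin n => ωb i)
      (M := fun n => M (ωb n)) (by simp [wordProd]) (fun n => wordProd_succ M _) (fun n => hK _ (wordProd_mem hmem _)) hPR
      (fun n => hMP (ωb n)) hω'
  · rw [hPeq, hket]
end
end

section
/- Let (Ω, F, p) be a probability space and M : Ω → M_d(ℂ) a random reduced dynamics operator with fixed invariant unit vector ψ_S, and suppose p({ω : M(ω) ∈ ℳ_(E)}) > 0. Assume in addition that there is a single vector ψ ∈ ℂ^d such that ψ(ω) = ψ for p-almost every ω. Then there exist constants C > 0 and α > 0 and a set of full ℙ-measure in Ω^{ℕ*} on which, for all sufficiently large n, ‖M(ω_1) M(ω_2) ⋯ M(ω_n) − |ψ_S⟩⟨ψ|‖ ≤ C e^{−α n}; in particular lim_{n→∞} M(ω_1) ⋯ M(ω_n) = |ψ_S⟩⟨ψ| almost surely, with exponential speed. -/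
open scoped BigOperators
open MeasureTheory Filter ContinuousLinearMap

noncomputable section

open ProbabilityTheory ENNReal in
/-- Products of independent `[0, ∞]`-valued variables of mean at most `r ^ 2` with `r < 1`
decay at least like `r ^ m`. -/
theorem ae_eventually_prod_lt_pow {Ω : Type*} [MeasurableSpace Ω] {μ : Measure Ω}
    {g : ℕ → Ω → ℝ≥0∞} (hg : ∀ j, Measurable (g j)) (hind : iIndepFun g μ)
    {r : ℝ≥0∞} (hr0 : r ≠ 0) (hr1 : r < 1) (hmean : ∀ j, ∫⁻ ω, g j ω ∂μ ≤ r ^ 2) :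
    ∀ᵐ ω ∂μ, ∀ᶠ m : ℕ in atTop, ∏ j ∈ Finset.range m, g j ω < r ^ m := by
  have hrt : r ≠ ∞ := (hr1.trans one_lt_top).ne
  have key : ∀ m : ℕ, μ {ω | r ^ m ≤ ∏ j ∈ Finset.range m, g j ω} ≤ r ^ m := by
    intro m
    refine (meas_ge_le_lintegral_div (Finset.aemeasurable_fun_prod _
      fun j _ => (hg j).aemeasurable) (pow_ne_zero _ hr0) (pow_ne_top hrt)).trans ?_
    rw [lintegral_prod_eq_prod_lintegral_of_indepFun _ _ hind hg]
    refine ENNReal.div_le_of_le_mul ?_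
    calc ∏ j ∈ Finset.range m, ∫⁻ ω, g j ω ∂μ ≤ ∏ _j ∈ Finset.range m, r ^ 2 :=
          Finset.prod_le_prod' fun j _ => hmean j
      _ = r ^ m * r ^ m := by simp [← pow_mul, ← pow_add]; ring_nf
  have hsum : ∑' m : ℕ, μ {ω | r ^ m ≤ ∏ j ∈ Finset.range m, g j ω} ≠ ∞ := by
    refine ne_top_of_le_ne_top ?_ (ENNReal.tsum_le_tsum key)
    rw [ENNReal.tsum_geometric]
    exact ENNReal.inv_ne_top.2 (tsub_pos_of_lt hr1).ne'
  filter_upwards [ae_eventually_notMem hsum] with ω hω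
  filter_upwards [hω] with m hm
  simpa using hm

/-- A measure on sequences whose finite-dimensional marginals are product measures assigns the
product mass to finite-dimensional boxes with equal sides. -/
theorem measure_pi_const_of_map_eq_pi {Ω : Type*} [MeasurableSpace Ω] {p : Measure Ω}
    [IsProbabilityMeasure p] {Pb : Measure (ℕ → Ω)}
    (hPb : ∀ n : ℕ, Pb.map (fun ωb (i : Fin n) => ωb i) = Measure.pi fun _ : Fin n => p)
    {V : Set Ω} (hV : MeasurableSet V) (S : Finset ℕ) :
    Pb (Set.pi S fun _ => V) = p V ^ S.card := by
  classical
  obtain ⟨n, hn⟩ := S.exists_nat_subset_range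
  have hset : (Set.pi S fun _ => V : Set (ℕ → Ω)) = (fun ωb (i : Fin n) => ωb i) ⁻¹'
      Set.pi Set.univ (fun i : Fin n => if (i : ℕ) ∈ S then V else Set.univ) := by
    ext ω
    simp only [Set.mem_pi, Finset.mem_coe, Set.mem_preimage, Set.mem_univ, true_implies]
    constructor
    · intro h i
      split_ifs with hi
      · exact h _ hi
      · trivial
    · intro h i hi
      simpa [hi] using h ⟨i, Finset.mem_range.1 (hn hi)⟩
  rw [hset, ← Measure.map_apply (by fun_prop), hPb, Measure.pi_pi]
  · have h1 : ∀ i : Fin n, p (if (i : ℕ) ∈ S then V else Set.univ)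
        = (fun i : ℕ => if i ∈ S then p V else 1) i := by
      intro i; dsimp only; split_ifs <;> simp
    rw [Finset.prod_congr rfl fun i _ => h1 i, Fin.prod_univ_eq_prod_range
      (fun i : ℕ => if i ∈ S then p V else 1), ← Finset.prod_filter, Finset.prod_const]
    congr 2
    ext i
    simpa using fun hi => Finset.mem_range.1 (hn hi)
  · refine MeasurableSet.univ_pi fun i => ?_
    split_ifs
    exacts [hV, .univ]

open ProbabilityTheory in
/-- For an iid sequence, disjoint consecutive blocks of length `k` lie entirely in `V`
independently of each other. -/
theorem iIndepSet_block {Ω : Type*} [MeasurableSpace Ω] {p : Measure Ω}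
    [IsProbabilityMeasure p] {Pb : Measure (ℕ → Ω)}
    (hPb : ∀ n : ℕ, Pb.map (fun ωb (i : Fin n) => ωb i) = Measure.pi fun _ : Fin n => p)
    {V : Set Ω} (hV : MeasurableSet V) (k : ℕ) :
    iIndepSet (fun j : ℕ => (Set.pi (Finset.Ico (j * k) (j * k + k)) fun _ => V : Set (ℕ → Ω)))
      Pb := by
  classical
  rw [iIndepSet_iff_meas_biInter
    fun j => MeasurableSet.pi (Finset.countable_toSet _) fun _ _ => hV]
  intro s
  have hset : (⋂ j ∈ s, (Set.pi (Finset.Ico (j * k) (j * k + k)) fun _ => V : Set (ℕ → Ω)))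
      = Set.pi (s.biUnion fun j => Finset.Ico (j * k) (j * k + k) : Finset ℕ) fun _ => V := by
    ext ω
    simp only [Set.mem_iInter, Set.mem_pi, Finset.mem_coe, Finset.mem_biUnion]
    exact ⟨fun h i ⟨j, hj, hi⟩ => h j hj i hi, fun h j hj i hi => h i ⟨j, hj, hi⟩⟩
  rw [hset, measure_pi_const_of_map_eq_pi hPb hV, Finset.card_biUnion,
    Finset.prod_congr rfl fun j _ => measure_pi_const_of_map_eq_pi hPb hV _,
    Finset.prod_pow_eq_pow_sum]
  intro i _ j _ hij
  rw [Function.onFun, Finset.disjoint_left]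
  intro a ha hb
  rw [Finset.mem_Ico] at ha hb
  refine hij (le_antisymm ?_ ?_) <;> by_contra! h <;> nlinarith [Nat.mul_le_mul_right k h]

open ProbabilityTheory in
/-- For an iid sequence, let each of the first `m` blocks of length `k` contribute a factor `1 / 2`
when it lies entirely in a set of positive measure; the product decays exponentially in `m`. -/
theorem exists_ae_eventually_prod_block_lt {Ω : Type*} [MeasurableSpace Ω] {p : Measure Ω}
    [IsProbabilityMeasure p] {Pb : Measure (ℕ → Ω)} [IsProbabilityMeasure Pb]
    (hPb : ∀ n : ℕ, Pb.map (fun ωb (i : Fin n) => ωb i) = Measure.pi fun _ : Fin n => p)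
    {V : Set Ω} (hV : MeasurableSet V) (hpV : 0 < p V) (k : ℕ) {g : ℕ → (ℕ → Ω) → ℝ}
    (hg : ∀ j ωb, g j ωb =
      1 - (Set.pi (Finset.Ico (j * k) (j * k + k)) fun _ => V).indicator (fun _ => 1 / 2) ωb) :
    ∃ r : ℝ, 0 < r ∧ r < 1 ∧
      ∀ᵐ ωb ∂Pb, ∀ᶠ m : ℕ in atTop, ∏ j ∈ Finset.range m, g j ωb < r ^ m := by
  set B : ℕ → Set (ℕ → Ω) := fun j => Set.pi (Finset.Ico (j * k) (j * k + k)) fun _ => V with hB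
  have hBm : ∀ j, MeasurableSet (B j) :=
    fun j => MeasurableSet.pi (Finset.countable_toSet _) fun _ _ => hV
  set q : ℝ := (p V).toReal ^ k with hq
  have hq0 : 0 < q := pow_pos (ENNReal.toReal_pos hpV.ne' (measure_ne_top _ _)) _
  have hq1 : q ≤ 1 := pow_le_one₀ ENNReal.toReal_nonneg
    (ENNReal.toReal_le_of_le_ofReal zero_le_one (by simpa using prob_le_one))
  have hBq : ∀ j, Pb.real (B j) = q := by
    intro j
    rw [Measure.real, hB, measure_pi_const_of_map_eq_pi hPb hV]
    simp [hq]
  set r : ℝ := Real.sqrt (1 - q / 2) with hr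
  have hr0 : 0 < r := Real.sqrt_pos.2 (by linarith)
  have hr1 : r < 1 := by rw [hr, Real.sqrt_lt' one_pos]; linarith
  have hr2 : r ^ 2 = 1 - q / 2 := Real.sq_sqrt (by linarith)
  have hg0 : ∀ j ωb, 0 ≤ g j ωb := by
    classical
    intro j ωb
    rw [hg, Set.indicator_apply]
    split_ifs <;> norm_num
  have hgB : ∀ j, g j = fun ωb => 1 - (B j).indicator (fun _ => 1 / 2 : (ℕ → Ω) → ℝ) ωb :=
    fun j => funext (hg j)
  have hgm : ∀ j, Measurable (g j) := by
    intro j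
    rw [hgB]
    exact measurable_const.sub (measurable_const.indicator (hBm j))
  have hint : ∀ j, Integrable ((B j).indicator (fun _ => 1 / 2 : (ℕ → Ω) → ℝ)) Pb :=
    fun j => (integrable_const _).indicator (hBm j)
  refine ⟨r, hr0, hr1, ?_⟩
  have hind : iIndepFun (fun j ωb => ENNReal.ofReal (g j ωb)) Pb := by
    classical
    have h1 := (iIndepSet_block hPb hV k).iIndepFun_indicator (β := ℝ)
      (m := inferInstance)
    have h2 := h1.comp (fun _ x => ENNReal.ofReal (1 - x / 2)) (fun _ => by fun_prop)
    convert! h2 using 3 with j ωb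
    simp only [Function.comp_apply, hg, Set.indicator_apply]
    split_ifs <;> norm_num
  have main := ae_eventually_prod_lt_pow (r := ENNReal.ofReal r)
    (fun j => (hgm j).ennreal_ofReal) hind (by simpa using hr0) (by simpa using hr1) (by
      intro j
      rw [← ofReal_integral_eq_lintegral_ofReal, ← ENNReal.ofReal_pow hr0.le, hr2, hgB,
        integral_sub (integrable_const _) (hint j), integral_indicator_const _ (hBm j), hBq]
      · simp [div_eq_mul_inv]
      · rw [hgB]
        exact (integrable_const _).sub (hint j)
      · exact ae_of_all _ (hg0 j))
  filter_upwards [main] with ωb h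
  filter_upwards [h] with m hm
  rw [← ENNReal.ofReal_prod_of_nonneg fun j _ => hg0 j ωb, ← ENNReal.ofReal_pow hr0.le] at hm
  exact (ENNReal.ofReal_lt_ofReal_iff (pow_pos hr0 _)).1 hm

/-- A definite seminorm on `ℂ^d` is equivalent to the Euclidean norm. -/
theorem exists_seminorm_bounds {d : ℕ} (Nrm : Seminorm ℂ (Evec d))
    (hNrm : ∀ x, Nrm x = 0 → x = 0) :
    ∃ a b : ℝ, 0 < a ∧ 0 < b ∧ ∀ x, Nrm x ≤ a * ‖x‖ ∧ ‖x‖ ≤ b * Nrm x := by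
  set e := EuclideanSpace.basisFun (Fin d) ℂ
  set a : ℝ := ∑ i, Nrm (e i) + 1
  have ha : 0 < a := add_pos_of_nonneg_of_pos
    (Finset.sum_nonneg fun i _ => apply_nonneg _ _) one_pos
  have hup : ∀ x, Nrm x ≤ a * ‖x‖ := by
    intro x
    calc Nrm x = Nrm (∑ i, x i • e i) := by
          congr 1
          simpa [e] using (e.sum_repr x).symm
      _ ≤ ∑ i, Nrm (x i • e i) :=
          Finset.le_sum_of_subadditive Nrm (map_zero Nrm).le (map_add_le_add Nrm) _ _
      _ = ∑ i, ‖x i‖ * Nrm (e i) := by simp [map_smul_eq_mul]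
      _ ≤ ∑ i, ‖x‖ * Nrm (e i) := by
          gcongr with i
          exact PiLp.norm_apply_le x i
      _ ≤ a * ‖x‖ := by rw [← Finset.mul_sum]; nlinarith [norm_nonneg x]
  have hcont : Continuous Nrm := by
    refine (LipschitzWith.of_dist_le_mul (K := ⟨a, ha.le⟩) fun x y => ?_).continuous
    rw [Real.dist_eq, dist_eq_norm]
    exact (abs_sub_map_le_sub Nrm x y).trans (hup _)
  rcases (Metric.sphere (0 : Evec d) 1).eq_empty_or_nonempty with hS | hS
  · refine ⟨a, 1, ha, one_pos, fun x => ⟨hup x, ?_⟩⟩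
    by_cases hx : x = 0
    · simp [hx]
    · have : (‖x‖⁻¹ : ℂ) • x ∈ Metric.sphere (0 : Evec d) 1 := by
        simp [norm_smul, hx]
      simp [hS] at this
  · obtain ⟨z, hz, hmin⟩ := (isCompact_sphere (0 : Evec d) 1).exists_isMinOn hS hcont.continuousOn
    have hz0 : 0 < Nrm z := by
      refine lt_of_le_of_ne (apply_nonneg _ _) fun h => ?_
      have := hNrm z h.symm
      simp [this] at hz
    refine ⟨a, (Nrm z)⁻¹, ha, inv_pos.2 hz0, fun x => ⟨hup x, ?_⟩⟩
    by_cases hx : x = 0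
    · simp [hx]
    have hx' : 0 < ‖x‖ := norm_pos_iff.2 hx
    have hmem : (‖x‖⁻¹ : ℂ) • x ∈ Metric.sphere (0 : Evec d) 1 := by
      simp [norm_smul, hx]
    have := isMinOn_iff.1 hmin _ hmem
    rw [map_smul_eq_mul] at this
    have h2 : ‖((‖x‖ : ℂ))⁻¹‖ = ‖x‖⁻¹ := by simp
    rw [h2, inv_mul_eq_div, le_div_iff₀ hx'] at this
    rw [inv_mul_eq_div, le_div_iff₀ hz0]
    linarith

/-- The Cesàro averages of a contraction for a definite seminorm converge, and the limit `P`
satisfies `P A = P`. -/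
theorem tendsto_cesaroProj {d : ℕ} {Nrm : Seminorm ℂ (Evec d)}
    (hNrm : ∀ x, Nrm x = 0 → x = 0) {A : Op d} (hA : ∀ x, Nrm (A x) ≤ Nrm x) :
    Tendsto (fun N : ℕ => (N : ℂ)⁻¹ • ∑ k ∈ Finset.range N, A ^ k) atTop (nhds (cesaroProj A)) ∧
      cesaroProj A * A = cesaroProj A := by
  obtain ⟨a, b, ha, hb, hab⟩ := exists_seminorm_bounds Nrm hNrm
  set S : ℕ → Op d := fun N => (N : ℂ)⁻¹ • ∑ k ∈ Finset.range N, A ^ k with hS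
  have hpow : ∀ k x, Nrm ((A ^ k) x) ≤ Nrm x := by
    intro k
    induction k with
    | zero => simp
    | succ k ih =>
      intro x
      rw [pow_succ']
      exact (hA _).trans (ih x)
  have hbd : ∀ k, ‖A ^ k‖ ≤ b * a := by
    intro k
    refine opNorm_le_bound _ (by positivity) fun x => ?_
    calc _ ≤ b * Nrm ((A ^ k) x) := (hab _).2
      _ ≤ b * (a * ‖x‖) := by gcongr; exact (hpow k x).trans (hab x).1
      _ = _ := by ring
  have hSbd : ∀ N, ‖S N‖ ≤ b * a := by
    intro N
    rw [hS]
    dsimp only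
    rw [norm_smul, norm_inv, Complex.norm_natCast]
    rcases N.eq_zero_or_pos with rfl | hN
    · simp; positivity
    have hN' : (0 : ℝ) < N := by exact_mod_cast hN
    rw [inv_mul_le_iff₀ hN']
    refine (norm_sum_le _ _).trans ?_
    simpa using Finset.sum_le_sum fun k (_ : k ∈ Finset.range N) => hbd k
  have hdiff : ∀ N, (S N * A - S N = (N : ℂ)⁻¹ • (A ^ N - 1)) ∧ A * S N = S N * A := by
    intro N
    refine ⟨?_, ?_⟩
    · simp only [hS]
      rw [smul_mul_assoc, ← geom_sum_mul, mul_sub, mul_one]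
      exact (smul_sub _ _ _).symm
    · simp only [hS]
      rw [smul_mul_assoc, mul_smul_comm, Finset.sum_mul, Finset.mul_sum]
      simp_rw [← pow_succ, ← pow_succ']
  have hdiff0 : Tendsto (fun N => S N * A - S N) atTop (nhds 0) := by
    rw [tendsto_zero_iff_norm_tendsto_zero]
    refine squeeze_zero (fun _ => norm_nonneg _)
      (g := fun N : ℕ => (b * a + ‖(1 : Op d)‖) / (N : ℝ))
      (fun N => ?_) (tendsto_const_div_atTop_nhds_zero_nat _)
    rw [(hdiff N).1, norm_smul, norm_inv, Complex.norm_natCast, inv_mul_eq_div]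
    gcongr
    exact (norm_sub_le _ _).trans (by gcongr; exact hbd N)
  have hclust : ∀ P : Op d, MapClusterPt P atTop S →
      P * A = P ∧ A * P = P ∧ ∃ φ : ℕ → ℕ, Tendsto φ atTop atTop ∧
        Tendsto (S ∘ φ) atTop (nhds P) := by
    intro P hP
    obtain ⟨φ, hφ, hlim⟩ := hP.tendsto_subseq
    have h1 : P * A - P = 0 := tendsto_nhds_unique
      ((hlim.mul_const A).sub hlim) (hdiff0.comp hφ.tendsto_atTop)
    have h2 : A * P = P * A := by
      refine tendsto_nhds_unique (hlim.const_mul A) ?_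
      simpa only [Function.comp_apply, (hdiff _).2] using hlim.mul_const A
    exact ⟨sub_eq_zero.1 h1, h2.trans (sub_eq_zero.1 h1), φ, hφ.tendsto_atTop, hlim⟩
  have hPS : ∀ P : Op d, P * A = P → A * P = P → ∀ N, 0 < N → P * S N = P ∧ S N * P = P := by
    intro P h1 h2 N hN
    have hk1 : ∀ k, P * A ^ k = P := fun k => by
      induction k with
      | zero => simp
      | succ k ih => rw [pow_succ, ← mul_assoc, ih, h1]
    have hk2 : ∀ k, A ^ k * P = P := fun k => by
      induction k with
      | zero => simp
      | succ k ih => rw [pow_succ, mul_assoc, h2, ih]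
    have hN' : (N : ℂ) ≠ 0 := by exact_mod_cast hN.ne'
    simp only [hS, mul_smul_comm, smul_mul_assoc, Finset.mul_sum, Finset.sum_mul, hk1, hk2,
      Finset.sum_const, Finset.card_range]
    rw [← Nat.cast_smul_eq_nsmul ℂ, smul_smul, inv_mul_cancel₀ hN', one_smul]
    exact ⟨rfl, rfl⟩
  have huniq : ∀ P P' : Op d, MapClusterPt P atTop S → MapClusterPt P' atTop S → P = P' := by
    intro P P' hP hP'
    obtain ⟨h1, h2, φ, hφ, hlim⟩ := hclust P hP
    obtain ⟨h1', h2', φ', hφ', hlim'⟩ := hclust P' hP'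
    have e1 : P * P' = P := by
      refine tendsto_nhds_unique (hlim'.const_mul P) (tendsto_const_nhds.congr' ?_)
      filter_upwards [hφ'.eventually_gt_atTop 0] with n hn
      exact (hPS P h1 h2 _ hn).1.symm
    have e2 : P * P' = P' := by
      refine tendsto_nhds_unique (hlim.mul_const P') (tendsto_const_nhds.congr' ?_)
      filter_upwards [hφ.eventually_gt_atTop 0] with n hn
      exact (hPS P' h1' h2' _ hn).2.symm
    exact e1.symm.trans e2
  have hcomp : IsCompact (Metric.closedBall (0 : Op d) (b * a)) := isCompact_closedBall _ _
  have hmem : ∀ N, S N ∈ Metric.closedBall (0 : Op d) (b * a) := fun N => by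
    simpa using hSbd N
  obtain ⟨P, -, φ, hφ, hφlim⟩ := hcomp.tendsto_subseq hmem
  have hPcl : MapClusterPt P atTop S := hφlim.mapClusterPt.of_comp hφ.tendsto_atTop
  have hlim : Tendsto S atTop (nhds P) :=
    hcomp.tendsto_nhds_of_unique_mapClusterPt (Eventually.of_forall hmem)
      fun P' _ hP' => huniq P' P hP' hPcl
  have hces : cesaroProj A = P := hlim.limUnder_eq
  rw [hces]
  exact ⟨hlim, (hclust P hPcl).1⟩

/-- `ψ(A) = P₁* ψ_S` is a left-invariant vector of `A`, normalised against `ψ_S`. -/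
theorem inner_psiOf {d : ℕ} {Nrm : Seminorm ℂ (Evec d)}
    (hNrm : ∀ x, Nrm x = 0 → x = 0) {A : Op d} (hA : ∀ x, Nrm (A x) ≤ Nrm x)
    {ψS : Evec d} (hψS : ‖ψS‖ = 1) (hfix : A ψS = ψS) :
    (∀ x, inner ℂ (psiOf ψS A) (A x) = inner ℂ (psiOf ψS A) x) ∧
      inner ℂ (psiOf ψS A) ψS = 1 := by
  obtain ⟨hlim, hPA⟩ := tendsto_cesaroProj hNrm hA
  simp only [psiOf, adjoint_inner_left]
  refine ⟨fun x => ?_, ?_⟩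
  · rw [← mul_apply_eq_comp, hPA]
  · have hpow : ∀ k : ℕ, (A ^ k) ψS = ψS := fun k => by
      induction k with
      | zero => simp
      | succ k ih => rw [pow_succ, mul_apply_eq_comp, hfix, ih]
    have hP : cesaroProj A ψS = ψS := by
      refine tendsto_nhds_unique
        (((ContinuousLinearMap.apply ℂ (Evec d) ψS).continuous.tendsto _).comp hlim)
        (tendsto_const_nhds.congr' ?_)
      filter_upwards [eventually_gt_atTop 0] with N hN
      have hN' : (N : ℂ) ≠ 0 := by exact_mod_cast hN.ne'
      simp [hpow, ← Nat.cast_smul_eq_nsmul ℂ, smul_smul, hN']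
    rw [hP, inner_self_eq_norm_sq_to_K, hψS]
    simp

theorem ketBra_apply {d : ℕ} (u v x : Evec d) : ketBra u v x = inner ℂ v x • u := rfl

/-- If every spectral value has modulus less than one, then the powers tend to zero. -/
theorem tendsto_pow_of_spectrum_lt_one {d : ℕ} [Nontrivial (Op d)] {A : Op d}
    (h : ∀ z ∈ spectrum ℂ A, ‖z‖ < 1) : Tendsto (fun n : ℕ => A ^ n) atTop (nhds 0) := by
  have hr : spectralRadius ℂ A < ((1 : NNReal) : ENNReal) :=
    spectrum.spectralRadius_lt_of_forall_lt A fun z hz => by exact_mod_cast h z hz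
  obtain ⟨s, hs1, hs2⟩ := exists_between hr
  have hs : s ≠ ⊤ := (hs2.trans ENNReal.coe_lt_top).ne
  have hlim := spectrum.pow_nnnorm_pow_one_div_tendsto_nhds_spectralRadius A
  have hs0 : Tendsto (fun n : ℕ => s.toReal ^ n) atTop (nhds 0) :=
    tendsto_pow_atTop_nhds_zero_of_lt_one ENNReal.toReal_nonneg
      (by simpa using (ENNReal.toReal_lt_toReal hs ENNReal.coe_ne_top).2 hs2)
  refine squeeze_zero_norm' ?_ hs0
  filter_upwards [hlim.eventually_lt_const hs1, eventually_gt_atTop 0] with n hn hn0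
  have hn0' : (n : ℝ) ≠ 0 := by exact_mod_cast hn0.ne'
  have h1 : (‖A ^ n‖₊ : ENNReal) ≤ s ^ n := by
    have := ENNReal.rpow_le_rpow hn.le (Nat.cast_nonneg n : (0 : ℝ) ≤ n)
    rwa [← ENNReal.rpow_mul, one_div_mul_cancel hn0', ENNReal.rpow_one, ENNReal.rpow_natCast] at this
  have := ENNReal.toReal_mono (ENNReal.pow_ne_top hs) h1
  simpa using this

/-- For `A` in `ℳ_(E)` with left-invariant vector `ψ` normalised against `ψ_S`, the operator
`A - |ψ_S⟩⟨ψ|` has no spectrum outside the open unit disc. -/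
theorem norm_lt_one_of_mem_spectrum_sub_ketBra {d : ℕ} {ψS ψ : Evec d} {A : Op d}
    (hψS : ψS ≠ 0) (hA : mcalE ψS A)
    (hinv : ∀ x, inner ℂ ψ (A x) = inner ℂ ψ x) (hone : inner ℂ ψ ψS = 1)
    {z : ℂ} (hz : z ∈ spectrum ℂ (A - ketBra ψS ψ)) : ‖z‖ < 1 := by
  obtain ⟨⟨Nrm, hNrm, hcon⟩, hfix, hspec, hrank⟩ := hA
  by_contra! hge
  have hz0 : z ≠ 0 := by rintro rfl; norm_num at hge
  have hcompact : ∀ T : Op d, IsCompactOperator T :=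
    fun T => isCompactOperator_of_locallyCompactSpace_dom T
  obtain ⟨x, hx⟩ := ((hcompact _).hasEigenvalue_iff_mem_spectrum hz0).2 hz |>.exists_hasEigenvector
  have hx0 : x ≠ 0 := hx.2
  have hNx : A x - inner ℂ ψ x • ψS = z • x := hx.apply_eq_smul
  have hψx : inner ℂ ψ x = 0 := by
    have := congrArg (inner ℂ ψ) hNx
    rw [inner_sub_right, inner_smul_right, inner_smul_right, hinv, hone, mul_one, sub_self] at this
    simpa [hz0] using this.symm
  have hAx : A x = z • x := by simpa [hψx] using hNx
  have hNx0 : 0 < Nrm x := lt_of_le_of_ne (apply_nonneg _ _) fun h => hx0 (hNrm x h.symm)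
  have hle : ‖z‖ ≤ 1 := by
    have := hcon x
    rw [hAx, map_smul_eq_mul] at this
    exact le_of_mul_le_mul_right (by linarith) hNx0
  have hev : Module.End.HasEigenvector (A : Module.End ℂ (Evec d)) z x :=
    ⟨Module.End.mem_eigenspace_iff.2 hAx, hx0⟩
  have hzA : z ∈ spectrum ℂ A :=
    ((hcompact A).hasEigenvalue_iff_mem_spectrum hz0).1
      (Module.End.hasEigenvalue_of_hasEigenvector hev)
  have hz1 : z = 1 := by
    have : z ∈ spectrum ℂ A ∩ {z : ℂ | ‖z‖ = 1} := ⟨hzA, le_antisymm hle hge⟩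
    rwa [hspec] at this
  subst hz1
  have hmem : ∀ y, A y = y →
      y ∈ Module.End.maxGenEigenspace (A : Evec d →ₗ[ℂ] Evec d) 1 := by
    intro y hy
    refine Module.End.mem_maxGenEigenspace _ _ _ |>.2 ⟨1, ?_⟩
    simp [hy]
  obtain ⟨c, hc⟩ := (finrank_eq_one_iff_of_nonzero'
    (⟨ψS, hmem ψS hfix⟩ : Module.End.maxGenEigenspace (A : Evec d →ₗ[ℂ] Evec d) 1)
    (by simpa using hψS)).1 hrank ⟨x, hmem x (by simpa using hAx)⟩
  have hc' : c • ψS = x := congrArg Subtype.val hc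
  rw [← hc', inner_smul_right, hone, mul_one] at hψx
  exact hx0 (by rw [← hc', hψx, zero_smul])

/-- Near a point of `ℳ_(E)` all products of a suitable length are uniformly contracting on the
kernel of the left-invariant functional. -/
theorem exists_uniform_contraction {d : ℕ} {Nrm : Seminorm ℂ (Evec d)}
    (hNrm : ∀ x, Nrm x = 0 → x = 0) {ψS ψ : Evec d} {A : Op d}
    (hψS : ψS ≠ 0) (hA : mcalE ψS A)
    (hinv : ∀ x, inner ℂ ψ (A x) = inner ℂ ψ x) (hone : inner ℂ ψ ψS = 1) :
    ∃ k : ℕ, 0 < k ∧ ∃ δ : ℝ, 0 < δ ∧ ∀ f : Fin k → Op d, (∀ i, f i ∈ Metric.ball A δ) →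
      ∀ y, inner ℂ ψ y = 0 → Nrm ((List.ofFn f).prod y) ≤ 1 / 2 * Nrm y := by
  obtain ⟨a, b, ha, hb, hab⟩ := exists_seminorm_bounds Nrm hNrm
  have : Nontrivial (Evec d) := nontrivial_of_ne _ _ hψS
  have hlim := tendsto_pow_of_spectrum_lt_one
    fun z hz => norm_lt_one_of_mem_spectrum_sub_ketBra hψS hA hinv hone hz
  set ε : ℝ := 1 / (4 * (a * b)) with hε
  have hε0 : 0 < ε := by positivity
  obtain ⟨k, hk, hk0⟩ := ((hlim.eventually (Metric.ball_mem_nhds _ hε0)).and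
    (eventually_gt_atTop 0)).exists
  rw [dist_zero_right] at hk
  have hpow : ∀ n : ℕ, ∀ y, inner ℂ ψ y = 0 →
      ((A - ketBra ψS ψ) ^ n) y = (A ^ n) y ∧ inner ℂ ψ ((A ^ n) y) = 0 := by
    intro n
    induction n with
    | zero => intro y hy; simpa using hy
    | succ n ih =>
      intro y hy
      obtain ⟨h1, h2⟩ := ih y hy
      rw [pow_succ', pow_succ', mul_apply_eq_comp, mul_apply_eq_comp, h1, hinv]
      exact ⟨by rw [sub_apply, ketBra_apply, h2, zero_smul, sub_zero], h2⟩
  have hcont : Continuous fun f : Fin k → Op d => (List.ofFn f).prod := by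
    simp_rw [List.ofFn_eq_map]
    exact continuous_list_prod _ fun i _ => continuous_apply i
  obtain ⟨δ, hδ, hball⟩ := Metric.continuousAt_iff.1 (hcont.continuousAt (x := fun _ => A)) ε hε0
  refine ⟨k, hk0, δ, hδ, fun f hf y hy => ?_⟩
  have h1 := hball ((dist_pi_lt_iff hδ).2 fun i => Metric.mem_ball.1 (hf i))
  rw [List.ofFn_const, List.prod_replicate, dist_eq_norm] at h1
  set P := (List.ofFn f).prod
  have hPy : ‖P y‖ ≤ 2 * ε * ‖y‖ := by
    have hdec : P y = (P - A ^ k) y + ((A - ketBra ψS ψ) ^ k) y := by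
      rw [(hpow k y hy).1, sub_apply, sub_add_cancel]
    rw [hdec]
    refine (norm_add_le _ _).trans ?_
    have e1 := le_of_opNorm_le _ h1.le y
    have e2 := le_of_opNorm_le _ hk.le y
    linarith
  calc Nrm (P y) ≤ a * ‖P y‖ := (hab _).1
    _ ≤ a * (2 * ε * (b * Nrm y)) := by
        gcongr
        exact hPy.trans (by gcongr; exact (hab y).2)
    _ = 1 / 2 * Nrm y := by rw [hε]; field_simp; norm_num

theorem prod_ofFn_add {R : Type*} [Monoid R] (f : ℕ → R) (m n : ℕ) :
    (List.ofFn fun i : Fin (m + n) => f i).prod =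
      (List.ofFn fun i : Fin m => f i).prod * (List.ofFn fun i : Fin n => f (m + i)).prod := by
  simp [List.ofFn_add]

theorem inner_prod_ofFn {d : ℕ} {ψ : Evec d} {f : ℕ → Op d}
    (hinv : ∀ i x, inner ℂ ψ (f i x) = inner ℂ ψ x) (n : ℕ) (x : Evec d) :
    inner ℂ ψ ((List.ofFn fun i : Fin n => f i).prod x) = inner ℂ ψ x := by
  induction n generalizing x with
  | zero => simp
  | succ n ih => rw [prod_ofFn_add, mul_apply_eq_comp, ih]; simpa using hinv n x

theorem seminorm_prod_ofFn_le {d : ℕ} {Nrm : Seminorm ℂ (Evec d)} {f : ℕ → Op d}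
    (hcon : ∀ i x, Nrm (f i x) ≤ Nrm x) (n : ℕ) (x : Evec d) :
    Nrm ((List.ofFn fun i : Fin n => f i).prod x) ≤ Nrm x := by
  induction n generalizing x with
  | zero => simp
  | succ n ih =>
    rw [prod_ofFn_add, mul_apply_eq_comp]
    exact (ih _).trans (by simpa using hcon n x)

theorem prod_ofFn_apply_fixed {d : ℕ} {u : Evec d} {f : ℕ → Op d}
    (hfix : ∀ i, f i u = u) (n : ℕ) : (List.ofFn fun i : Fin n => f i).prod u = u := by
  induction n with
  | zero => simp
  | succ n ih => rw [prod_ofFn_add, mul_apply_eq_comp]; simpa [hfix] using ih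

/-- Contraction factors of consecutive blocks multiply. -/
theorem seminorm_prod_ofFn_le_prod {d : ℕ} {Nrm : Seminorm ℂ (Evec d)} {ψ : Evec d}
    {f : ℕ → Op d} (hcon : ∀ i x, Nrm (f i x) ≤ Nrm x)
    (hinv : ∀ i x, inner ℂ ψ (f i x) = inner ℂ ψ x) {k : ℕ} {g : ℕ → ℝ} (hg0 : ∀ j, 0 ≤ g j)
    (hg : ∀ j y, inner ℂ ψ y = 0 →
      Nrm ((List.ofFn fun i : Fin k => f (j * k + i)).prod y) ≤ g j * Nrm y)
    (m r : ℕ) {y : Evec d} (hy : inner ℂ ψ y = 0) :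
    Nrm ((List.ofFn fun i : Fin (m * k + r) => f i).prod y) ≤
      (∏ j ∈ Finset.range m, g j) * Nrm y := by
  have hblock : ∀ (m : ℕ) (y : Evec d), inner ℂ ψ y = 0 →
      Nrm ((List.ofFn fun i : Fin (m * k) => f i).prod y) ≤
        (∏ j ∈ Finset.range m, g j) * Nrm y := by
    intro m
    induction m with
    | zero => intro y _; simp
    | succ m ih =>
      intro y hy
      rw [Nat.succ_mul, prod_ofFn_add, mul_apply_eq_comp, Finset.prod_range_succ, mul_assoc]
      refine (ih _ ?_).trans (mul_le_mul_of_nonneg_left (hg m y hy)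
        (Finset.prod_nonneg fun j _ => hg0 j))
      rw [inner_prod_ofFn (fun i => hinv (m * k + i)), hy]
  rw [prod_ofFn_add, mul_apply_eq_comp]
  refine (hblock m _ ?_).trans (mul_le_mul_of_nonneg_left
    (seminorm_prod_ofFn_le (fun i => hcon (m * k + i)) r y)
    (Finset.prod_nonneg fun j _ => hg0 j))
  rw [inner_prod_ofFn (fun i => hinv (m * k + i)), hy]

theorem norm_sub_ketBra_le {d : ℕ} {Nrm : Seminorm ℂ (Evec d)} {a b : ℝ} (ha : 0 < a) (hb : 0 < b)
    (hab : ∀ x, Nrm x ≤ a * ‖x‖ ∧ ‖x‖ ≤ b * Nrm x) {ψS ψ : Evec d} (hψS : ‖ψS‖ = 1)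
    (hone : inner ℂ ψ ψS = 1) {T : Op d} (hT : T ψS = ψS) {c : ℝ} (hc : 0 ≤ c)
    (h : ∀ y, inner ℂ ψ y = 0 → Nrm (T y) ≤ c * Nrm y) :
    ‖T - ketBra ψS ψ‖ ≤ b * a * (1 + ‖ψ‖) * c := by
  refine opNorm_le_bound _ (by positivity) fun x => ?_
  set y := x - inner ℂ ψ x • ψS with hy
  have hψy : inner ℂ ψ y = 0 := by
    rw [hy, inner_sub_right, inner_smul_right, hone, mul_one, sub_self]
  have hTy : (T - ketBra ψS ψ) x = T y := by
    rw [sub_apply, ketBra_apply, hy, map_sub, map_smul, hT]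
  have hynorm : ‖y‖ ≤ (1 + ‖ψ‖) * ‖x‖ := by
    refine (norm_sub_le _ _).trans ?_
    rw [norm_smul, hψS, mul_one, add_mul, one_mul]
    gcongr
    exact norm_inner_le_norm _ _
  rw [hTy]
  calc ‖T y‖ ≤ b * Nrm (T y) := (hab _).2
    _ ≤ b * (c * (a * ((1 + ‖ψ‖) * ‖x‖))) := by
        gcongr
        refine (h y hψy).trans ?_
        gcongr
        exact (hab y).1.trans (by gcongr)
    _ = _ := by ring

theorem pow_div_le_exp {r : ℝ} (hr0 : 0 < r) (hr1 : r < 1) {k : ℕ} (hk : 0 < k) (n : ℕ) :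
    r ^ (n / k) ≤ r⁻¹ * Real.exp (-(-Real.log r / k) * n) := by
  have hk' : (0 : ℝ) < k := by exact_mod_cast hk
  have hlt : (n : ℝ) < ((n / k : ℕ) + 1) * k := by
    exact_mod_cast Nat.lt_mul_of_div_lt (Nat.lt_succ_self (n / k)) hk
  have hlog : Real.log r < 0 := Real.log_neg hr0 hr1
  have h1 : ((n / k : ℕ) + 1) * Real.log r ≤ -(-Real.log r / k) * n := by
    have : -(-Real.log r / k) * n = n / k * Real.log r := by ring
    rw [this]
    exact mul_le_mul_of_nonpos_right ((div_le_iff₀ hk').2 hlt.le) hlog.le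
  rw [inv_mul_eq_div, le_div_iff₀ hr0, ← pow_succ]
  calc r ^ (n / k + 1) = Real.exp (((n / k : ℕ) + 1) * Real.log r) := by
        rw [← Real.rpow_natCast, Real.rpow_def_of_pos hr0]
        push_cast
        ring_nf
    _ ≤ _ := Real.exp_le_exp.2 h1

theorem map_eval_of_map_eq_pi {Ω : Type*} [MeasurableSpace Ω] {p : Measure Ω}
    [IsProbabilityMeasure p] {Pb : Measure (ℕ → Ω)}
    (hPb : ∀ n : ℕ, Pb.map (fun ωb (i : Fin n) => ωb i) = Measure.pi fun _ : Fin n => p) (i : ℕ) :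
    Pb.map (fun ωb => ωb i) = p := by
  ext V hV
  rw [Measure.map_apply (measurable_pi_apply i) hV]
  have := measure_pi_const_of_map_eq_pi hPb hV {i}
  simpa using this

/-- if moreover `ψ(ω) = ψ` for `p`-a.e. `ω`, then almost surely
`M(ω_1) ⋯ M(ω_n) → |ψ_S⟩⟨ψ|` with exponential speed.
Here `ω̄ = (ω̄ 0, ω̄ 1, …)` stands for `(ω_1, ω_2, …)`. -/
theorem stmt14 {d : ℕ} (hd : 1 ≤ d) {Ω : Type*} [MeasurableSpace Ω]
    (p : Measure Ω) [IsProbabilityMeasure p]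
    (M : Ω → Op d) (hMmeas : Measurable M)
    (Nrm : Seminorm ℂ (Evec d)) (hNrm : ∀ x, Nrm x = 0 → x = 0)
    (hcontr : ∀ (ω : Ω) (x : Evec d), Nrm (M ω x) ≤ Nrm x)
    (ψS : Evec d) (hψS : ‖ψS‖ = 1) (hfix : ∀ ω, M ω ψS = ψS)
    (Pb : Measure (ℕ → Ω)) [IsProbabilityMeasure Pb]
    (hPb : ∀ n : ℕ, Pb.map (fun ωb (i : Fin n) => ωb i) = Measure.pi fun _ : Fin n => p)
    (hpos : 0 < p {ω | mcalE ψS (M ω)})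
    (ψ : Evec d) (hconst : ∀ᵐ ω ∂p, psiOf ψS (M ω) = ψ) :
    ∃ C α : ℝ, 0 < C ∧ 0 < α ∧
      ∃ Ωfull : Set (ℕ → Ω), Pb Ωfull = 1 ∧
        ∀ ωb ∈ Ωfull,
          (∃ N : ℕ, ∀ n : ℕ, N ≤ n →
            ‖(List.ofFn fun i : Fin n => M (ωb i)).prod - ketBra ψS ψ‖
              ≤ C * Real.exp (-α * n)) ∧
          Tendsto (fun n : ℕ => (List.ofFn fun i : Fin n => M (ωb i)).prod) atTop
            (nhds (ketBra ψS ψ)) := by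
  have hψS0 : ψS ≠ 0 := by rintro rfl; simp at hψS
  have hinvM : ∀ ω, psiOf ψS (M ω) = ψ → ∀ x, inner ℂ ψ (M ω x) = inner ℂ ψ x :=
    fun ω hω => hω ▸ (inner_psiOf hNrm (hcontr ω) hψS (hfix ω)).1
  obtain ⟨ω₀, hω₀⟩ := hconst.exists
  have hone : inner ℂ ψ ψS = 1 := hω₀ ▸ (inner_psiOf hNrm (hcontr ω₀) hψS (hfix ω₀)).2
  obtain ⟨a, b, ha, hb, hab⟩ := exists_seminorm_bounds Nrm hNrm
  have hs : p.map M {A | mcalE ψS A ∧ psiOf ψS A = ψ} ≠ 0 := by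
    refine ((hpos.trans_le (measure_mono_ae ?_)).trans_le
      (Measure.le_map_apply hMmeas.aemeasurable _)).ne'
    filter_upwards [hconst] with ω hω hE
    exact ⟨hE, hω⟩
  obtain ⟨A, ⟨hAE, hAψ⟩, hAnhds⟩ := exists_mem_forall_mem_nhdsWithin_pos_measure hs
  have hinvA : ∀ x, inner ℂ ψ (A x) = inner ℂ ψ x := by
    obtain ⟨⟨N', hN', hcon'⟩, hfix', -, -⟩ := hAE
    exact hAψ ▸ (inner_psiOf hN' hcon' hψS hfix').1
  obtain ⟨k, hk, δ, hδ, hcontract⟩ := exists_uniform_contraction hNrm hψS0 hAE hinvA hone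
  set V : Set Ω := M ⁻¹' Metric.ball A δ with hVdef
  have hV : MeasurableSet V := hMmeas Metric.isOpen_ball.measurableSet
  have hpV : 0 < p V := by
    rw [hVdef, ← Measure.map_apply hMmeas Metric.isOpen_ball.measurableSet]
    exact hAnhds _ (mem_nhdsWithin_of_mem_nhds (Metric.ball_mem_nhds A hδ))
  set B : ℕ → Set (ℕ → Ω) := fun j => Set.pi (Finset.Ico (j * k) (j * k + k)) fun _ => V with hB
  set g : ℕ → (ℕ → Ω) → ℝ := fun j ωb => 1 - (B j).indicator (fun _ => 1 / 2) ωb with hg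
  obtain ⟨r, hr0, hr1, hdecay⟩ :=
    exists_ae_eventually_prod_block_lt (g := g) hPb hV hpV k (fun _ _ => rfl)
  have hψae : ∀ᵐ ωb ∂Pb, ∀ i, psiOf ψS (M (ωb i)) = ψ := by
    refine ae_all_iff.2 fun i => ?_
    refine ae_of_ae_map (f := fun ωb : ℕ → Ω => ωb i) (p := fun ω => psiOf ψS (M ω) = ψ)
      (measurable_pi_apply i).aemeasurable ?_
    rwa [map_eval_of_map_eq_pi hPb]
  set K : ℝ := b * a * (1 + ‖ψ‖)
  have hK : 0 < K := by positivity
  have hα : 0 < -Real.log r / k :=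
    div_pos (neg_pos.2 (Real.log_neg hr0 hr1)) (by exact_mod_cast hk)
  have hbound : ∀ ωb : ℕ → Ω, (∀ i, psiOf ψS (M (ωb i)) = ψ) → ∀ n : ℕ,
      ‖(List.ofFn fun i : Fin n => M (ωb i)).prod - ketBra ψS ψ‖ ≤
        K * ∏ j ∈ Finset.range (n / k), g j ωb := by
    classical
    intro ωb hψ n
    have hg0 : ∀ j, 0 ≤ g j ωb := by
      intro j
      simp only [hg, Set.indicator_apply]
      split_ifs <;> norm_num
    have hgB : ∀ j y, inner ℂ ψ y = 0 →
        Nrm ((List.ofFn fun i : Fin k => M (ωb (j * k + i))).prod y) ≤ g j ωb * Nrm y := by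
      intro j y hy
      by_cases hmem : ωb ∈ B j
      · have hfac : g j ωb = 1 / 2 := by
          simp only [hg, Set.indicator_of_mem hmem]
          norm_num
        rw [hfac]
        refine hcontract _ (fun i => hmem (j * k + i) ?_) y hy
        simp
      · have hfac : g j ωb = 1 := by
          simp only [hg, Set.indicator_of_notMem hmem, sub_zero]
        rw [hfac, one_mul]
        exact seminorm_prod_ofFn_le (f := fun i => M (ωb (j * k + i))) (fun i => hcontr _) k y
    refine norm_sub_ketBra_le ha hb hab hψS hone
      (prod_ofFn_apply_fixed (f := fun i => M (ωb i)) (fun i => hfix _) n)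
      (Finset.prod_nonneg fun j _ => hg0 j) fun y hy => ?_
    have := seminorm_prod_ofFn_le_prod (f := fun i => M (ωb i)) (fun i => hcontr _)
      (fun i => hinvM _ (hψ i)) hg0 hgB (n / k) (n % k) hy
    rwa [Nat.div_add_mod'] at this
  have hexp : ∀ ωb : ℕ → Ω, (∀ i, psiOf ψS (M (ωb i)) = ψ) →
      (∀ᶠ m : ℕ in atTop, ∏ j ∈ Finset.range m, g j ωb < r ^ m) → ∀ᶠ n : ℕ in atTop,
        ‖(List.ofFn fun i : Fin n => M (ωb i)).prod - ketBra ψS ψ‖ ≤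
          K * r⁻¹ * Real.exp (-(-Real.log r / k) * n) := by
    intro ωb hψ hev
    filter_upwards [(Nat.tendsto_div_const_atTop hk.ne').eventually hev] with n hn
    rw [mul_assoc]
    exact (hbound ωb hψ n).trans
      (mul_le_mul_of_nonneg_left (hn.le.trans (pow_div_le_exp hr0 hr1 hk n)) hK.le)
  refine ⟨K * r⁻¹, -Real.log r / k, by positivity, hα,
    {ωb | (∀ i, psiOf ψS (M (ωb i)) = ψ) ∧
      ∀ᶠ m : ℕ in atTop, ∏ j ∈ Finset.range m, g j ωb < r ^ m}, ?_, ?_⟩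
  · rw [measure_congr (eventuallyEq_univ.2 (hψae.and hdecay)), measure_univ]
  rintro ωb ⟨hψ, hev⟩
  have hev' := hexp ωb hψ hev
  refine ⟨eventually_atTop.1 hev', tendsto_iff_norm_sub_tendsto_zero.2
    (squeeze_zero' (Eventually.of_forall fun _ => norm_nonneg _) hev' ?_)⟩
  have : Tendsto (fun n : ℕ => -(-Real.log r / k) * (n : ℝ)) atTop atBot :=
    tendsto_natCast_atTop_atTop.const_mul_atTop_of_neg (neg_lt_zero.2 hα)
  simpa using (Real.tendsto_exp_atBot.comp this).const_mul (K * r⁻¹)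
end
end

section
/- Let (Ω, F, p) be a probability space and M : Ω → M_d(ℂ) a random reduced dynamics operator with fixed invariant unit vector ψ_S, and suppose p({ω : M(ω) ∈ ℳ_(E)}) > 0. For ω̄ ∈ Ω^{ℕ*} set Φ_n(ω̄) := M(ω_n) M(ω_{n−1}) ⋯ M(ω_1). Then there exist α > 0, a set Ω_4 ⊆ Ω^{ℕ*} with ℙ(Ω_4) = 1, and a random vector η_∞ : Ω^{ℕ*} → ℂ^d, given for ω̄ ∈ Ω_4 by the convergent series η_∞(ω̄) = lim_{n→∞} [ ψ(ω_1) + M_Q^*(ω_1) ψ(ω_2) + ⋯ + M_Q^*(ω_1) ⋯ M_Q^*(ω_{n−1}) ψ(ω_n) ], such that for every ω̄ ∈ Ω_4 there is a constant C_{ω̄} with ‖ Φ_n(ω̄) − |ψ_S⟩⟨η_∞(ω̄)| ‖ ≤ C_{ω̄} e^{−α n} for all n ∈ ℕ*. -/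
open scoped BigOperators
open MeasureTheory Filter ContinuousLinearMap

noncomputable section

theorem eq_infinitePi_of_map_fin {Ω : Type*} [MeasurableSpace Ω] (p : Measure Ω)
    [IsProbabilityMeasure p] (Pb : Measure (ℕ → Ω))
    (hPb : ∀ n : ℕ, Pb.map (fun ωb (i : Fin n) => ωb i) = Measure.pi fun _ : Fin n => p) :
    Pb = Measure.infinitePi fun _ : ℕ => p := by
  classical
  refine Measure.eq_infinitePi _ fun s t ht => ?_
  obtain ⟨n, hn⟩ : ∃ n, s ⊆ Finset.range n := s.exists_nat_subset_range
  set u : ℕ → Set Ω := fun i => if i ∈ s then t i else Set.univ with hu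
  have hum : ∀ i, MeasurableSet (u i) := by
    intro i
    by_cases h : i ∈ s
    · simpa [hu, h] using ht i
    · simp [hu, h]
  have hpre : Set.pi (s : Set ℕ) t
      = (fun ωb (i : Fin n) => ωb i) ⁻¹' Set.pi Set.univ fun i : Fin n => u i := by
    ext x
    simp only [Set.mem_pi, Finset.mem_coe, Set.mem_preimage, Set.mem_univ, true_implies, hu]
    constructor
    · intro h i
      by_cases hi : (i : ℕ) ∈ s
      · simpa [hi] using h i hi
      · simp [hi]
    · intro h i hi
      simpa [hi] using h ⟨i, Finset.mem_range.1 (hn hi)⟩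
  have hmeas : Measurable fun (ωb : ℕ → Ω) (i : Fin n) => ωb i := by fun_prop
  rw [hpre, ← Measure.map_apply hmeas (MeasurableSet.univ_pi fun i : Fin n => hum i), hPb,
    Measure.pi_pi, Fin.prod_univ_eq_prod_range (fun i => p (u i)) n]
  rw [← Finset.prod_subset hn]
  · exact Finset.prod_congr rfl fun i hi => by simp [hu, hi]
  · intro i _ hi
    simp [hu, hi]

open ProbabilityTheory in
/-- Almost surely, a positive fraction of the disjoint length-`k` blocks of an iid sequence
consists only of elements of a given set of positive probability. -/
theorem ae_eventually_le_card_blocks {Ω : Type*} [MeasurableSpace Ω] (p : Measure Ω)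
    [IsProbabilityMeasure p] {A : Set Ω} (hA : MeasurableSet A) (hpA : p A ≠ 0) (k : ℕ) :
    ∃ δ : ℝ, 0 < δ ∧ ∀ᵐ ωb ∂(Measure.infinitePi fun _ : ℕ => p), ∀ᶠ m : ℕ in atTop,
      δ * m ≤ ∑ j ∈ Finset.range m,
        Set.indicator {ωb : ℕ → Ω | ∀ i < k, ωb (j * k + i) ∈ A} (fun _ => (1 : ℝ)) ωb := by
  classical
  set P := Measure.infinitePi fun _ : ℕ => p with hP
  set G : ℕ → Set (ℕ → Ω) := fun j => {ωb | ∀ i < k, ωb (j * k + i) ∈ A} with hG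
  have hGm : ∀ j, MeasurableSet (G j) := by
    intro j
    have : G j = ⋂ i, ⋂ (_ : i < k), (fun ωb : ℕ → Ω => ωb (j * k + i)) ⁻¹' A := by
      ext; simp [hG]
    rw [this]
    exact MeasurableSet.iInter fun i => MeasurableSet.iInter fun _ =>
      (measurable_pi_apply _) hA
  set Y : ℕ → (ℕ → Ω) → ℝ := fun j => (G j).indicator fun _ => 1 with hY
  have hYm : ∀ j, Measurable (Y j) := fun j => measurable_const.indicator (hGm j)
  have hind : iIndepFun (fun (i : ℕ) (ωb : ℕ → Ω) => ωb i) P :=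
    iIndepFun_infinitePi (X := fun _ ω => ω) (fun _ => measurable_id)
  have hpair : Pairwise (Function.onFun (fun f g => IndepFun f g P) Y) := by
    intro a b hab
    have hdisj : Disjoint (Finset.Ico (a * k) (a * k + k)) (Finset.Ico (b * k) (b * k + k)) := by
      rw [Finset.disjoint_left]
      intro x hx hx'
      rw [Finset.mem_Ico] at hx hx'
      rcases lt_or_gt_of_ne hab with h | h <;> nlinarith
    have h := hind.indepFun_finset _ _ hdisj (fun i => measurable_pi_apply i)
    let g (j : ℕ) (x : Finset.Ico (j * k) (j * k + k) → Ω) : ℝ :=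
      {x : Finset.Ico (j * k) (j * k + k) → Ω | ∀ i, x i ∈ A}.indicator (fun _ => 1) x
    have hg : ∀ j, Measurable (g j) := by
      intro j
      refine measurable_const.indicator ?_
      have : {x : Finset.Ico (j * k) (j * k + k) → Ω | ∀ i, x i ∈ A}
          = Set.pi Set.univ fun _ => A := by ext; simp
      rw [this]
      exact MeasurableSet.univ_pi fun _ => hA
    have hYg : ∀ j, Y j = g j ∘ fun ωb (i : Finset.Ico (j * k) (j * k + k)) => ωb i := by
      intro j
      ext ωb
      simp only [hY, g, Function.comp, Set.indicator_apply]
      congr 1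
      simp only [hG, Set.mem_ofPred_eq, eq_iff_iff, Subtype.forall, Finset.mem_Ico]
      constructor
      · rintro h i ⟨h1, h2⟩
        have := h (i - j * k) (by omega)
        rwa [Nat.add_sub_cancel' h1] at this
      · intro h i hi
        exact h _ ⟨by omega, by omega⟩
    simp only [Function.onFun]
    rw [hYg a, hYg b]
    exact h.comp (hg a) (hg b)
  have hident : ∀ j, IdentDistrib (Y j) (Y 0) P P := by
    intro j
    have hmp : P.map (fun ωb i => ωb (j * k + i)) = P :=
      Measure.map_infinitePi_infinitePi_of_inj (P := fun _ : ℕ => p)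
        (f := fun i => j * k + i) (fun _ _ h => by simpa using h)
    have hcomp : Y j = Y 0 ∘ fun ωb i => ωb (j * k + i) := by
      ext ωb
      simp [hY, hG, Set.indicator_apply]
    refine ⟨(hYm j).aemeasurable, (hYm 0).aemeasurable, ?_⟩
    rw [hcomp, ← Measure.map_map (hYm 0) (by fun_prop), hmp]
  have hint : Integrable (Y 0) P := (integrable_const (1 : ℝ)).indicator (hGm 0)
  have hP0 : P (G 0) = p A ^ k := by
    have : G 0 = Set.pi (Finset.range k : Set ℕ) fun _ => A := by
      ext; simp [hG]
    rw [this, hP, Measure.infinitePi_pi _ (fun _ _ => hA)]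
    simp
  have hE : P[Y 0] = (p A ^ k).toReal := by
    simp only [hY]
    rw [integral_indicator_const _ (hGm 0)]
    simp [Measure.real, hP0]
  have hpos : 0 < (p A ^ k).toReal :=
    ENNReal.toReal_pos (pow_ne_zero _ hpA) (ENNReal.pow_ne_top (measure_ne_top _ _))
  refine ⟨(p A ^ k).toReal / 2, by positivity, ?_⟩
  filter_upwards [strong_law_ae_real Y hint hpair hident] with ωb hω
  rw [hE] at hω
  filter_upwards [hω.eventually_const_le (half_lt_self hpos), eventually_gt_atTop 0] with m hm hm0
  rwa [le_div_iff₀ (by exact_mod_cast hm0)] at hm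

theorem norm_ketBra {d : ℕ} (u v : Evec d) : ‖ketBra u v‖ = ‖v‖ * ‖u‖ := by
  simp [ketBra, ContinuousLinearMap.norm_smulRight_apply]

theorem ketBra_add {d : ℕ} (u v w : Evec d) : ketBra u (v + w) = ketBra u v + ketBra u w := by
  ext1 x; simp [ketBra_apply, add_smul]

theorem ketBra_sub {d : ℕ} (u v w : Evec d) : ketBra u (v - w) = ketBra u v - ketBra u w := by
  ext1 x; simp [ketBra_apply, sub_smul]

theorem mul_ketBra {d : ℕ} (A : Op d) (u v : Evec d) : A * ketBra u v = ketBra (A u) v := by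
  ext1 x; simp [ketBra_apply]

theorem ketBra_mul {d : ℕ} (A : Op d) (u v : Evec d) :
    ketBra u v * A = ketBra u (adjoint A v) := by
  ext1 x; simp [ketBra_apply, ContinuousLinearMap.adjoint_inner_left]

/-- The time-ordered product `T (n - 1) * ⋯ * T 1 * T 0`. -/
def prodSeq {R : Type*} [Monoid R] (T : ℕ → R) : ℕ → R
  | 0 => 1
  | n + 1 => T n * prodSeq T n

theorem prodSeq_add {R : Type*} [Monoid R] (T : ℕ → R) (n k : ℕ) :
    prodSeq T (n + k) = prodSeq (fun i => T (n + i)) k * prodSeq T n := by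
  induction k with
  | zero => simp [prodSeq]
  | succ k ih => rw [← add_assoc, prodSeq, ih, prodSeq, mul_assoc]

theorem prodSeq_eq_prod_ofFn {R : Type*} [Monoid R] (T : ℕ → R) (n : ℕ) :
    prodSeq T n = (List.ofFn fun i : Fin n => T (n - 1 - i)).prod := by
  induction n with
  | zero => simp [prodSeq]
  | succ n ih =>
    rw [List.ofFn_succ, List.prod_cons, prodSeq, ih]
    simp only [Fin.val_zero, Fin.val_succ]
    congr 4
    ext i
    congr 1
    omega

theorem prod_ofFn_adjoint {d : ℕ} (S : ℕ → Op d) (n : ℕ) :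
    (List.ofFn fun i : Fin n => adjoint (S i)).prod = adjoint (prodSeq S n) := by
  induction n with
  | zero =>
    simp only [List.ofFn_zero, List.prod_nil, prodSeq]
    exact (star_one (Op d)).symm
  | succ n ih =>
    rw [List.ofFn_succ', List.concat_eq_append, List.prod_append, List.prod_singleton, prodSeq]
    simp only [Fin.val_castSucc, Fin.val_last]
    rw [ih]
    exact (star_mul (S n) (prodSeq S n)).symm

theorem prodSeq_apply_of_fixed {d : ℕ} {T : ℕ → Op d} {ψ : Evec d} (h : ∀ n, T n ψ = ψ) (n : ℕ) :
    prodSeq T n ψ = ψ := by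
  induction n with
  | zero => simp [prodSeq]
  | succ n ih => simp [prodSeq, ih, h]

theorem exists_nhds_prodSeq_mem {R : Type*} [Monoid R] [TopologicalSpace R] [ContinuousMul R]
    (A : R) (k : ℕ) {U : Set R} (hU : U ∈ nhds (A ^ k)) :
    ∃ V ∈ nhds A, ∀ T : ℕ → R, (∀ i < k, T i ∈ V) → prodSeq T k ∈ U := by
  induction k generalizing U with
  | zero => exact ⟨Set.univ, univ_mem, fun T _ => by simpa [prodSeq] using mem_of_mem_nhds hU⟩
  | succ k ih =>
    rw [pow_succ'] at hU
    have hc : Tendsto (fun x : R × R => x.1 * x.2) (nhds A ×ˢ nhds (A ^ k))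
        (nhds (A * A ^ k)) := by
      rw [← nhds_prod_eq]; exact continuous_mul.tendsto _
    obtain ⟨V₁, h₁, V₂, h₂, hV⟩ := Filter.mem_prod_iff.1 (hc hU)
    obtain ⟨V, hVA, hVT⟩ := ih h₂
    refine ⟨V₁ ∩ V, inter_mem h₁ hVA, fun T hT => ?_⟩
    exact hV (Set.mk_mem_prod (hT k k.lt_succ_self).1
      (hVT T fun i hi => (hT i (by omega)).2))

theorem exists_norm_equiv {d : ℕ} (Nrm : Seminorm ℂ (Evec d)) (hNrm : ∀ x, Nrm x = 0 → x = 0) :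
    ∃ a b : ℝ, 0 ≤ a ∧ 0 ≤ b ∧ (∀ x, Nrm x ≤ a * ‖x‖) ∧ ∀ x, ‖x‖ ≤ b * Nrm x := by
  set a := ∑ i, Nrm (EuclideanSpace.basisFun (Fin d) ℂ i) with ha
  have hale : ∀ x, Nrm x ≤ a * ‖x‖ := by
    intro x
    calc Nrm x = Nrm (∑ i, x i • EuclideanSpace.basisFun (Fin d) ℂ i) := by
          conv_lhs => rw [← (EuclideanSpace.basisFun (Fin d) ℂ).sum_repr x]
          simp
      _ ≤ ∑ i, Nrm (x i • EuclideanSpace.basisFun (Fin d) ℂ i) :=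
          Finset.le_sum_of_subadditive Nrm (map_zero Nrm).le (map_add_le_add Nrm) _ _
      _ ≤ ∑ i, Nrm (EuclideanSpace.basisFun (Fin d) ℂ i) * ‖x‖ := by
          refine Finset.sum_le_sum fun i _ => ?_
          rw [map_smul_eq_mul, mul_comm]
          exact mul_le_mul_of_nonneg_left (PiLp.norm_apply_le x i) (apply_nonneg _ _)
      _ = a * ‖x‖ := by rw [ha, Finset.sum_mul]
  have ha0 : 0 ≤ a := Finset.sum_nonneg fun i _ => apply_nonneg _ _
  have hcont : Continuous Nrm := by
    refine (LipschitzWith.of_dist_le_mul (K := a.toNNReal) fun x y => ?_).continuous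
    rw [Real.coe_toNNReal _ ha0, dist_eq_norm, dist_eq_norm, Real.norm_eq_abs]
    exact (abs_sub_map_le_sub Nrm x y).trans (hale _)
  rcases (Metric.sphere (0 : Evec d) 1).eq_empty_or_nonempty with he | hne
  · refine ⟨a, 0, ha0, le_rfl, hale, fun x => ?_⟩
    have : x = 0 := by
      by_contra hx
      have hmem : (‖x‖⁻¹ : ℂ) • x ∈ Metric.sphere (0 : Evec d) 1 := by
        simp [norm_smul, hx]
      simp [he] at hmem
    simp [this]
  · obtain ⟨x₀, hx₀, hmin⟩ := (isCompact_sphere (0 : Evec d) 1).exists_isMinOn hne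
      hcont.continuousOn
    have hpos : 0 < Nrm x₀ := by
      refine lt_of_le_of_ne (apply_nonneg _ _) fun h => ?_
      rw [hNrm x₀ h.symm] at hx₀
      simp at hx₀
    refine ⟨a, (Nrm x₀)⁻¹, ha0, by positivity, hale, fun x => ?_⟩
    by_cases hx : x = 0
    · simp [hx]
    have hmem : (‖x‖⁻¹ : ℂ) • x ∈ Metric.sphere (0 : Evec d) 1 := by
      simp [norm_smul, hx]
    have := hmin hmem
    simp only [Set.mem_ofPred_eq, map_smul_eq_mul] at this
    rw [inv_mul_eq_div, le_div_iff₀ hpos]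
    have hn : 0 < ‖x‖ := norm_pos_iff.2 hx
    simp only [norm_inv, Complex.norm_real, norm_norm] at this
    rw [inv_mul_eq_div, le_div_iff₀ hn] at this
    linarith

theorem inv_smul_sum_range_const {E : Type*} [AddCommGroup E] [Module ℂ E] {N : ℕ} (hN : N ≠ 0)
    (x : E) : (N : ℂ)⁻¹ • ∑ _k ∈ Finset.range N, x = x := by
  rw [Finset.sum_const, Finset.card_range, ← Nat.cast_smul_eq_nsmul ℂ, smul_smul,
    inv_mul_cancel₀ (by exact_mod_cast hN), one_smul]

theorem norm_inv_smul_sum_range_le {E : Type*} [NormedAddCommGroup E] [NormedSpace ℂ E]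
    {f : ℕ → E} {K : ℝ} (hK : ∀ k, ‖f k‖ ≤ K) (N : ℕ) :
    ‖(N : ℂ)⁻¹ • ∑ k ∈ Finset.range N, f k‖ ≤ K := by
  rcases Nat.eq_zero_or_pos N with rfl | hN
  · simpa using (norm_nonneg _).trans (hK 0)
  rw [norm_smul, norm_inv, Complex.norm_natCast, inv_mul_eq_div,
    div_le_iff₀ (by exact_mod_cast hN), mul_comm]
  refine (norm_sum_le _ _).trans ((Finset.sum_le_card_nsmul _ _ K fun k _ => hK k).trans ?_)
  simp

theorem exists_tendsto_cesaro {d : ℕ} {A : Op d} {K : ℝ} (hK : ∀ k, ‖A ^ k‖ ≤ K) :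
    ∃ P : Op d, Tendsto (fun N : ℕ => (N : ℂ)⁻¹ • ∑ k ∈ Finset.range N, A ^ k) atTop (nhds P) ∧
      P * A = P := by
  set avg : ℕ → Op d := fun N => (N : ℂ)⁻¹ • ∑ k ∈ Finset.range N, A ^ k with havg
  have hbd : ∀ N, ‖avg N‖ ≤ K := norm_inv_smul_sum_range_le hK
  have hcomm : ∀ N, A * avg N = avg N * A := fun N => by
    simp only [havg, mul_smul_comm, smul_mul_assoc, Finset.mul_sum, Finset.sum_mul, ← pow_succ,
      ← pow_succ']
  have hlim : Tendsto (fun N => avg N * A - avg N) atTop (nhds 0) := by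
    have hle : ∀ N, ‖avg N * A - avg N‖ ≤ (2 * K) * (N : ℝ)⁻¹ := by
      intro N
      have : avg N * A - avg N = (N : ℂ)⁻¹ • (A ^ N - A ^ 0) := by
        rw [← Finset.sum_range_sub, Finset.sum_sub_distrib, smul_sub, havg]
        simp only [smul_mul_assoc, Finset.sum_mul, ← pow_succ]
      rw [this, norm_smul, norm_inv, Complex.norm_natCast, mul_comm]
      gcongr
      exact (norm_sub_le _ _).trans (by linarith [hK N, hK 0])
    refine squeeze_zero_norm hle ?_
    simpa using (tendsto_inv_atTop_nhds_zero_nat (𝕜 := ℝ)).const_mul (2 * K)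
  have hfix : ∀ (P : Op d) (φ : ℕ → ℕ), StrictMono φ → Tendsto (avg ∘ φ) atTop (nhds P) →
      P * A = P := by
    intro P φ hφ hP
    have h1 : Tendsto (fun n => avg (φ n) * A - avg (φ n)) atTop (nhds (P * A - P)) :=
      (hP.mul_const A).sub hP
    exact sub_eq_zero.1 (tendsto_nhds_unique h1 (hlim.comp hφ.tendsto_atTop))
  have hfix' : ∀ (P : Op d) (φ : ℕ → ℕ), StrictMono φ → Tendsto (avg ∘ φ) atTop (nhds P) →
      A * P = P := by
    intro P φ hφ hP
    refine (tendsto_nhds_unique (hP.const_mul A) ?_).trans (hfix P φ hφ hP)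
    simp only [Function.comp, hcomm]
    exact hP.mul_const A
  have hl : ∀ P : Op d, A * P = P → ∀ N, 0 < N → avg N * P = P := by
    intro P hP N hN
    have hp : ∀ k, A ^ k * P = P := fun k => by
      induction k with
      | zero => simp
      | succ k ih => rw [pow_succ, mul_assoc, hP, ih]
    simp only [havg, smul_mul_assoc, Finset.sum_mul, hp]
    exact inv_smul_sum_range_const hN.ne' _
  have hr : ∀ P : Op d, P * A = P → ∀ N, 0 < N → P * avg N = P := by
    intro P hP N hN
    have hp : ∀ k, P * A ^ k = P := fun k => by
      induction k with
      | zero => simp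
      | succ k ih => rw [pow_succ', ← mul_assoc, hP, ih]
    simp only [havg, mul_smul_comm, Finset.mul_sum, hp]
    exact inv_smul_sum_range_const hN.ne' _
  have hcpt : IsCompact (Metric.closedBall (0 : Op d) K) :=
    have : ProperSpace (Op d) := FiniteDimensional.proper ℂ _
    isCompact_closedBall _ _
  have hmem : ∀ N, avg N ∈ Metric.closedBall (0 : Op d) K := fun N => by simpa using hbd N
  obtain ⟨P, -, φ, hφ, hP⟩ := hcpt.tendsto_subseq hmem
  refine ⟨P, ?_, hfix P φ hφ hP⟩
  refine hcpt.le_nhds_of_unique_clusterPt (mem_map.2 (univ_mem' hmem)) fun P' _ hP' => ?_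
  obtain ⟨φ', hφ', hP'⟩ := MapClusterPt.tendsto_subseq hP'
  have h1 : P' * P = P := by
    refine tendsto_nhds_unique (hP'.mul_const P) (tendsto_const_nhds.congr' ?_)
    filter_upwards [eventually_gt_atTop 0] with n hn
    exact (hl P (hfix' P φ hφ hP) _ (hn.trans_le hφ'.le_apply)).symm
  have h2 : P' * P = P' := by
    refine tendsto_nhds_unique (hP.const_mul P') (tendsto_const_nhds.congr' ?_)
    filter_upwards [eventually_gt_atTop 0] with n hn
    exact (hr P' (hfix P' φ' hφ' hP') _ (hn.trans_le hφ.le_apply)).symm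
  exact h2.symm.trans h1

/-- The vector `ψ(ω)` is a left fixed vector normalized by `⟨ψ(ω), ψ_S⟩ = 1`. -/
structure IsLeftFixed {d : ℕ} (ψ : Evec d) (A : Op d) (w : Evec d) : Prop where
  inner_apply : ∀ x, inner ℂ w (A x) = inner ℂ w x
  inner_fixed : inner ℂ w ψ = 1

theorem psiOf_spec {d : ℕ} {A : Op d} {K : ℝ} (hK : ∀ k, ‖A ^ k‖ ≤ K) {ψ : Evec d}
    (hψ : ‖ψ‖ = 1) (hA : A ψ = ψ) :
    IsLeftFixed ψ A (psiOf ψ A) ∧ ‖psiOf ψ A‖ ≤ K := by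
  obtain ⟨P, hP, hPA⟩ := exists_tendsto_cesaro hK
  have hproj : cesaroProj A = P := hP.limUnder_eq
  have hPψ : P ψ = ψ := by
    have h1 : Tendsto (fun N : ℕ => ((N : ℂ)⁻¹ • ∑ k ∈ Finset.range N, A ^ k) ψ) atTop
        (nhds (P ψ)) :=
      ((ContinuousLinearMap.apply ℂ (Evec d) ψ).continuous.tendsto P).comp hP
    refine tendsto_nhds_unique h1 (tendsto_const_nhds.congr' ?_)
    filter_upwards [eventually_gt_atTop 0] with N hN
    have hp : ∀ k, (A ^ k) ψ = ψ := fun k => by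
      induction k with
      | zero => simp
      | succ k ih => simp [pow_succ, hA, ih]
    simp only [_root_.smul_apply, _root_.sum_apply, hp]
    exact (inv_smul_sum_range_const hN.ne' ψ).symm
  have hPK : ‖P‖ ≤ K :=
    le_of_tendsto hP.norm (Eventually.of_forall (norm_inv_smul_sum_range_le hK))
  refine ⟨⟨fun x => ?_, ?_⟩, ?_⟩
  · rw [psiOf, hproj, ContinuousLinearMap.adjoint_inner_left,
      ContinuousLinearMap.adjoint_inner_left]
    exact congrArg (fun B : Op d => inner ℂ ψ (B x)) hPA
  · rw [psiOf, hproj, ContinuousLinearMap.adjoint_inner_left, hPψ, inner_self_eq_norm_sq_to_K, hψ]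
    simp
  · rw [psiOf, hproj]
    refine (ContinuousLinearMap.le_opNorm _ _).trans ?_
    rw [hψ, mul_one, LinearIsometryEquiv.norm_map]
    exact hPK

theorem MQof_eq_sub_ketBra {d : ℕ} {ψ : Evec d} {A : Op d} (hA : A ψ = ψ)
    (h : IsLeftFixed ψ A (psiOf ψ A)) : MQof ψ A = A - ketBra ψ (psiOf ψ A) := by
  ext1 x
  simp [MQof, Qof, ketBra_apply, hA, h.inner_apply, h.inner_fixed]

theorem prodSeq_eq_ketBra_add {d : ℕ} {ψ : Evec d} {T : ℕ → Op d} (hT : ∀ n, T n ψ = ψ)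
    (w : ℕ → Evec d) (n : ℕ) :
    prodSeq T n = ketBra ψ (∑ k ∈ Finset.range n,
        adjoint (prodSeq (fun i => T i - ketBra ψ (w i)) k) (w k)) +
      prodSeq (fun i => T i - ketBra ψ (w i)) n := by
  induction n with
  | zero => ext1 x; simp [prodSeq, ketBra_apply]
  | succ n ih =>
    rw [prodSeq, ih, mul_add, mul_ketBra, hT, Finset.sum_range_succ, ketBra_add, prodSeq,
      sub_mul, ketBra_mul]
    abel

theorem norm_prodSeq_sub_ketBra_le {d : ℕ} {ψ : Evec d} (hψ : ‖ψ‖ = 1) {T : ℕ → Op d}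
    (hT : ∀ n, T n ψ = ψ) {w : ℕ → Evec d} (hw : ∀ n, IsLeftFixed ψ (T n) (w n)) {K : ℝ}
    (hK : ∀ n, ‖w n‖ ≤ K) (n : ℕ) :
    ‖prodSeq (fun i => T i - ketBra ψ (w i)) (n + 1)‖ ≤
      (1 + K) * ‖(1 - ketBra ψ ψ) * prodSeq T (n + 1)‖ := by
  have hK0 : 0 ≤ K := (norm_nonneg _).trans (hK 0)
  refine ContinuousLinearMap.opNorm_le_bound _ (by positivity) fun x => ?_
  set y := prodSeq (fun i => T i - ketBra ψ (w i)) (n + 1) x with hy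
  set z := ((1 - ketBra ψ ψ) * prodSeq T (n + 1)) x with hz
  have hzy : z = y - inner ℂ ψ y • ψ := by
    rw [hz, prodSeq_eq_ketBra_add hT w, mul_add, mul_ketBra]
    simp [ketBra_apply, hψ, ← hy]
  have hwy : inner ℂ (w n) y = 0 := by
    rw [hy, prodSeq]
    simp [ketBra_apply, (hw n).inner_apply, (hw n).inner_fixed]
  have hwz : inner ℂ (w n) z = -inner ℂ ψ y := by
    rw [hzy, inner_sub_right, inner_smul_right, hwy, (hw n).inner_fixed]
    ring
  have hyz : y = z - inner ℂ (w n) z • ψ := by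
    rw [hwz, hzy]; simp
  calc ‖y‖ = ‖z - inner ℂ (w n) z • ψ‖ := by rw [← hyz]
    _ ≤ ‖z‖ + ‖w n‖ * ‖z‖ := by
        refine (norm_sub_le _ _).trans ?_
        rw [norm_smul, hψ, mul_one]
        gcongr
        exact norm_inner_le_norm _ _
    _ ≤ ‖z‖ + K * ‖z‖ := by gcongr; exact hK n
    _ = (1 + K) * ‖z‖ := by ring
    _ ≤ (1 + K) * (‖(1 - ketBra ψ ψ) * prodSeq T (n + 1)‖ * ‖x‖) := by
        gcongr
        exact ContinuousLinearMap.le_opNorm _ _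
    _ = _ := by ring

/-- Exponential decay modulo the common fixed vector gives exponential convergence of the
time-ordered products. -/
theorem exists_tendsto_and_norm_sub_ketBra_le {d : ℕ} {ψ : Evec d} (hψ : ‖ψ‖ = 1) {T : ℕ → Op d}
    (hT : ∀ n, T n ψ = ψ) {w : ℕ → Evec d} (hw : ∀ n, IsLeftFixed ψ (T n) (w n)) {K : ℝ}
    (hK : ∀ n, ‖w n‖ ≤ K) {C ρ : ℝ} (hρ0 : 0 < ρ) (hρ1 : ρ < 1)
    (hC : ∀ n, ‖(1 - ketBra ψ ψ) * prodSeq T n‖ ≤ C * ρ ^ n) :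
    ∃ v : Evec d,
      Tendsto (fun n => ∑ k ∈ Finset.range n,
        adjoint (prodSeq (fun i => T i - ketBra ψ (w i)) k) (w k)) atTop (nhds v) ∧
      ∃ C' : ℝ, ∀ n, ‖prodSeq T n - ketBra ψ v‖ ≤ C' * ρ ^ n := by
  set S := prodSeq (fun i => T i - ketBra ψ (w i)) with hS
  set η : ℕ → Evec d := fun n => ∑ k ∈ Finset.range n, adjoint (S k) (w k) with hη
  have hK0 : 0 ≤ K := (norm_nonneg _).trans (hK 0)
  obtain ⟨C₁, hC₁⟩ : ∃ C₁, ∀ n, ‖S n‖ ≤ C₁ * ρ ^ n := by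
    refine ⟨max ‖S 0‖ ((1 + K) * C), fun n => ?_⟩
    cases n with
    | zero => simp
    | succ n =>
      refine (norm_prodSeq_sub_ketBra_le hψ hT hw hK n).trans ?_
      refine (mul_le_mul_of_nonneg_left (hC _) (by positivity)).trans ?_
      rw [← mul_assoc]
      gcongr
      exact le_max_right _ _
  have hdist : ∀ n, dist (η n) (η (n + 1)) ≤ (C₁ * K) * ρ ^ n := by
    intro n
    rw [dist_comm, dist_eq_norm]
    have hstep : η (n + 1) - η n = adjoint (S n) (w n) := by
      simp [hη, Finset.sum_range_succ]
    rw [hstep]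
    calc ‖adjoint (S n) (w n)‖ ≤ ‖adjoint (S n)‖ * ‖w n‖ := ContinuousLinearMap.le_opNorm _ _
      _ = ‖S n‖ * ‖w n‖ := by rw [LinearIsometryEquiv.norm_map]
      _ ≤ (C₁ * ρ ^ n) * K :=
          mul_le_mul (hC₁ n) (hK n) (norm_nonneg _) ((norm_nonneg _).trans (hC₁ n))
      _ = _ := by ring
  obtain ⟨v, hv⟩ := cauchySeq_tendsto_of_complete (cauchySeq_of_le_geometric ρ _ hρ1 hdist)
  refine ⟨v, hv, C₁ + C₁ * K / (1 - ρ), fun n => ?_⟩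
  have h1 : prodSeq T n - ketBra ψ v = ketBra ψ (η n - v) + S n := by
    rw [prodSeq_eq_ketBra_add hT w, ketBra_sub]
    abel
  have h2 := dist_le_of_le_geometric_of_tendsto ρ (C₁ * K) hρ1 hdist hv n
  rw [dist_eq_norm] at h2
  rw [h1]
  refine (norm_add_le _ _).trans ?_
  rw [norm_ketBra, hψ, mul_one]
  calc ‖η n - v‖ + ‖S n‖ ≤ C₁ * K * ρ ^ n / (1 - ρ) + C₁ * ρ ^ n := add_le_add h2 (hC₁ n)
    _ = _ := by ring

theorem tendsto_pow_zero_of_spectrum {B : Type*} [NormedRing B] [NormedAlgebra ℂ B]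
    [CompleteSpace B] [Nontrivial B] {a : B} (h : ∀ z ∈ spectrum ℂ a, ‖z‖ < 1) :
    Tendsto (fun k => a ^ k) atTop (nhds 0) := by
  have hr : spectralRadius ℂ a < (1 : NNReal) :=
    spectrum.spectralRadius_lt_of_forall_lt_of_nonempty (spectrum.nonempty a)
      fun z hz => by simpa [← NNReal.coe_lt_coe] using h z hz
  obtain ⟨s, hs, hs1⟩ := ENNReal.lt_iff_exists_nnreal_btwn.1 hr
  have hs1' : s < 1 := by exact_mod_cast hs1
  have hev := (spectrum.pow_nnnorm_pow_one_div_tendsto_nhds_spectralRadius a).eventually_lt_const hs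
  rw [tendsto_zero_iff_norm_tendsto_zero]
  refine squeeze_zero' (Eventually.of_forall fun _ => norm_nonneg _) ?_
    (tendsto_pow_atTop_nhds_zero_of_lt_one s.coe_nonneg (by exact_mod_cast hs1'))
  filter_upwards [hev, eventually_gt_atTop 0] with k hk hk0
  have hk0' : (0 : ℝ) < k := by exact_mod_cast hk0
  rw [one_div, ENNReal.rpow_inv_lt_iff hk0', ENNReal.rpow_natCast] at hk
  have : ‖a ^ k‖₊ < s ^ k := by exact_mod_cast hk
  exact_mod_cast this.le

theorem mcalE.tendsto_pow {d : ℕ} {ψ : Evec d} (hψ : ‖ψ‖ = 1) {A : Op d} (hA : mcalE ψ A)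
    {w : Evec d} (hw : IsLeftFixed ψ A w) :
    Tendsto (fun k => (1 - ketBra ψ ψ) * A ^ k) atTop (nhds 0) := by
  obtain ⟨⟨Nrm, hN0, hN⟩, hAψ, hspec, hdim⟩ := hA
  have hψ0 : ψ ≠ 0 := fun h => by simp [h] at hψ
  have : Nontrivial (Evec d) := ⟨ψ, 0, hψ0⟩
  have hlt : ∀ z ∈ spectrum ℂ (A - ketBra ψ w), ‖z‖ < 1 := by
    intro z hz
    have hspec_eq : ∀ B : Op d,
        spectrum ℂ B = spectrum ℂ (B : Evec d →ₗ[ℂ] Evec d) := fun B =>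
      AlgEquiv.spectrum_eq (Module.End.toContinuousLinearMap (𝕜 := ℂ) (Evec d))
        (B : Evec d →ₗ[ℂ] Evec d)
    rw [hspec_eq, ← Module.End.hasEigenvalue_iff_mem_spectrum] at hz
    obtain ⟨v, hv⟩ := hz.exists_hasEigenvector
    have hv0 : v ≠ 0 := hv.2
    have hzv : A v - inner ℂ w v • ψ = z • v := hv.apply_eq_smul
    by_contra! hz1
    have hz0 : z ≠ 0 := fun h => by simp [h] at hz1; linarith
    have hwv : inner ℂ w v = 0 := by
      have := congrArg (fun y => inner ℂ w y) hzv
      simp only [inner_sub_right, inner_smul_right, hw.inner_apply, hw.inner_fixed, mul_one,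
        sub_self] at this
      simpa [hz0] using this.symm
    have hAv : A v = z • v := by simpa [hwv] using hzv
    have hNv : 0 < Nrm v := lt_of_le_of_ne (apply_nonneg _ _) fun h => hv0 (hN0 v h.symm)
    have hzle : ‖z‖ ≤ 1 := by
      have := hN v
      rw [hAv, map_smul_eq_mul] at this
      exact le_of_mul_le_mul_right (by linarith) hNv
    have hzmem : z ∈ spectrum ℂ A := by
      rw [hspec_eq, ← Module.End.hasEigenvalue_iff_mem_spectrum]
      exact Module.End.hasEigenvalue_of_hasEigenvector
        (Module.End.hasEigenvector_iff.2 ⟨Module.End.mem_eigenspace_iff.2 hAv, hv0⟩)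
    have hz_one : z = 1 := by
      have : z ∈ spectrum ℂ A ∩ {z : ℂ | ‖z‖ = 1} := ⟨hzmem, le_antisymm hzle hz1⟩
      rwa [hspec] at this
    have hmem : ∀ x, A x = x →
        x ∈ Module.End.maxGenEigenspace (A : Evec d →ₗ[ℂ] Evec d) 1 := fun x hx =>
      (Module.End.genEigenspace (A : Evec d →ₗ[ℂ] Evec d) 1).monotone le_top
        (Module.End.mem_eigenspace_iff.2 (by simpa using hx))
    obtain ⟨c, hc⟩ := exists_smul_eq_of_finrank_eq_one hdim
      (x := ⟨ψ, hmem ψ hAψ⟩) (fun h => hψ0 (congrArg Subtype.val h))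
      ⟨v, hmem v (by rw [hAv, hz_one, one_smul])⟩
    have hc' : c • ψ = v := congrArg Subtype.val hc
    rw [← hc', inner_smul_right, hw.inner_fixed, mul_one] at hwv
    exact hv0 (by rw [← hc', hwv, zero_smul])
  have hlim := (tendsto_pow_zero_of_spectrum hlt).const_mul (1 - ketBra ψ ψ)
  rw [mul_zero] at hlim
  refine hlim.congr fun k => ?_
  have hpow : ∀ B : Op d, prodSeq (fun _ => B) k = B ^ k := fun B => by
    induction k with
    | zero => simp [prodSeq]
    | succ k ih => rw [prodSeq, ih, pow_succ']
  rw [← hpow A, prodSeq_eq_ketBra_add (fun _ => hAψ) (fun _ => w), hpow, mul_add, mul_ketBra]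
  ext1 x
  simp [ketBra_apply, hψ]

/-- The quotient norm modulo the line spanned by a common fixed vector is nonincreasing under
contractions. -/
theorem exists_quotient_norm {d : ℕ} (Nrm : Seminorm ℂ (Evec d)) (hNrm : ∀ x, Nrm x = 0 → x = 0)
    {ψ : Evec d} (hψ : ‖ψ‖ = 1) :
    ∃ (q : Evec d → ℝ) (a b : ℝ), 0 ≤ a ∧ 0 ≤ b ∧ (∀ x, 0 ≤ q x) ∧
      (∀ x, q x ≤ a * ‖(1 - ketBra ψ ψ) x‖) ∧ (∀ x, ‖(1 - ketBra ψ ψ) x‖ ≤ b * q x) ∧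
      ∀ A : Op d, (∀ x, Nrm (A x) ≤ Nrm x) → A ψ = ψ → ∀ x, q (A x) ≤ q x := by
  obtain ⟨a, b, ha, hb, hNa, hNb⟩ := exists_norm_equiv Nrm hNrm
  have hbdd : ∀ x, BddBelow (Set.range fun c : ℂ => Nrm (x + c • ψ)) := fun x =>
    ⟨0, by rintro _ ⟨c, rfl⟩; exact apply_nonneg _ _⟩
  refine ⟨fun x => ⨅ c : ℂ, Nrm (x + c • ψ), a, ‖1 - ketBra ψ ψ‖ * b, ha, by positivity,
    fun x => Real.iInf_nonneg fun c => apply_nonneg _ _, fun x => ?_, fun x => ?_,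
    fun A hA hAψ x => ?_⟩
  · refine (ciInf_le (hbdd x) (-inner ℂ ψ x)).trans ((hNa _).trans_eq ?_)
    simp [ketBra_apply, sub_eq_add_neg]
  · rw [Real.mul_iInf_of_nonneg (by positivity)]
    refine le_ciInf fun c => ?_
    have : (1 - ketBra ψ ψ) x = (1 - ketBra ψ ψ) (x + c • ψ) := by
      simp [ketBra_apply, hψ, add_smul]
    rw [this, mul_assoc]
    exact (ContinuousLinearMap.le_opNorm _ _).trans (by gcongr; exact hNb _)
  · refine ciInf_mono (hbdd _) fun c => ?_
    have : A x + c • ψ = A (x + c • ψ) := by simp [hAψ]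
    rw [this]
    exact hA _

/-- If sufficiently many disjoint blocks contract by one half, the products decay exponentially
modulo the common fixed vector. -/
theorem exists_norm_mul_prodSeq_le {d : ℕ} {ψ : Evec d} {T : ℕ → Op d} {q : Evec d → ℝ} {a b : ℝ}
    (ha : 0 ≤ a) (hb : 0 ≤ b) (hq0 : ∀ x, 0 ≤ q x)
    (hqa : ∀ x, q x ≤ a * ‖(1 - ketBra ψ ψ) x‖) (hqb : ∀ x, ‖(1 - ketBra ψ ψ) x‖ ≤ b * q x)
    (hq : ∀ n x, q (T n x) ≤ q x) {k : ℕ} (hk : 0 < k) {g : ℕ → ℝ}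
    (hg : ∀ j, g j = 0 ∨
      g j = 1 ∧ ∀ x, q (prodSeq (fun i => T (j * k + i)) k x) ≤ 1 / 2 * q x)
    {δ : ℝ} (hδ : 0 < δ) (hev : ∀ᶠ m : ℕ in atTop, δ * m ≤ ∑ j ∈ Finset.range m, g j) :
    ∃ C : ℝ, ∀ n, ‖(1 - ketBra ψ ψ) * prodSeq T n‖ ≤ C * Real.exp (-(Real.log 2 * δ / k)) ^ n := by
  have hmono : ∀ (T' : ℕ → Op d), (∀ n x, q (T' n x) ≤ q x) → ∀ n x, q (prodSeq T' n x) ≤ q x := by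
    intro T' hT' n x
    induction n with
    | zero => simp [prodSeq]
    | succ n ih => exact (hT' n _).trans ih
  have hblock : ∀ m x, q (prodSeq T (m * k) x)
      ≤ Real.exp (-(Real.log 2 * ∑ j ∈ Finset.range m, g j)) * q x := by
    intro m x
    induction m with
    | zero => simp [prodSeq]
    | succ m ih =>
      rw [Nat.succ_mul, prodSeq_add, Finset.sum_range_succ, _root_.mul_apply_eq_comp]
      rcases hg m with h | ⟨h, hx⟩
      · rw [h, add_zero]
        exact (hmono _ (fun n x => hq _ x) k _).trans ih
      · refine (hx _).trans ((mul_le_mul_of_nonneg_left ih (by norm_num)).trans_eq ?_)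
        rw [h, mul_add, neg_add, Real.exp_add, mul_one, Real.exp_neg (Real.log 2),
          Real.exp_log two_pos]
        ring
  have hk' : (0 : ℝ) < k := by exact_mod_cast hk
  have hlog : 0 < Real.log 2 := Real.log_pos one_lt_two
  set ρ := Real.exp (-(Real.log 2 * δ / k)) with hρ
  have hρpow : ∀ n : ℕ, ρ ^ n = Real.exp (-(Real.log 2 * δ * (n / k))) := fun n => by
    rw [hρ, ← Real.exp_nat_mul]; congr 1; field_simp
  set R : Op d := 1 - ketBra ψ ψ with hR
  set C₀ := b * (a * ‖R‖ * Real.exp (Real.log 2 * δ)) with hC₀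
  have hev' : ∀ᶠ n : ℕ in atTop, ‖R * prodSeq T n‖ ≤ C₀ * ρ ^ n := by
    have ht : Tendsto (fun n : ℕ => n / k) atTop atTop := Nat.tendsto_div_const_atTop hk.ne'
    filter_upwards [ht.eventually hev] with n hn
    refine ContinuousLinearMap.opNorm_le_bound _ (by positivity) fun x => ?_
    have hn' : (n : ℝ) / k ≤ ((n / k : ℕ) : ℝ) + 1 := by
      rw [div_le_iff₀ hk']
      rw [mul_comm]
      exact_mod_cast (Nat.lt_mul_div_succ n hk).le
    have hle : Real.exp (-(Real.log 2 * ∑ j ∈ Finset.range (n / k), g j))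
        ≤ Real.exp (Real.log 2 * δ) * ρ ^ n := by
      rw [hρpow, ← Real.exp_add, Real.exp_le_exp]
      nlinarith [mul_le_mul_of_nonneg_left hn hlog.le,
        mul_le_mul_of_nonneg_left hn' (mul_pos hlog hδ).le]
    have hsplit : n = n / k * k + n % k := (Nat.div_add_mod' n k).symm
    calc ‖(R * prodSeq T n) x‖ ≤ b * q (prodSeq T n x) := hqb _
      _ ≤ b * q (prodSeq T (n / k * k) x) := by
          gcongr
          nth_rewrite 1 [hsplit]
          rw [prodSeq_add]
          exact hmono _ (fun n x => hq _ x) _ _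
      _ ≤ b * (Real.exp (Real.log 2 * δ) * ρ ^ n * (a * (‖R‖ * ‖x‖))) := by
          gcongr
          refine (hblock _ x).trans (mul_le_mul hle ?_ (hq0 _) (by positivity))
          refine (hqa x).trans ?_
          gcongr
          exact ContinuousLinearMap.le_opNorm _ _
      _ = C₀ * ρ ^ n * ‖x‖ := by rw [hC₀]; ring
  have hO : (fun n => R * prodSeq T n) =O[atTop] fun n => ρ ^ n :=
    Asymptotics.IsBigO.of_bound C₀ (hev'.mono fun n hn => by
      rwa [Real.norm_of_nonneg (by positivity)])
  obtain ⟨C, -, hC⟩ := Asymptotics.bound_of_isBigO_nat_atTop hO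
  refine ⟨C, fun n => ?_⟩
  have := hC (x := n) (by positivity)
  rwa [Real.norm_of_nonneg (by positivity)] at this

/-- reverse-order products `Φ_n(ω̄) = M(ω_n) ⋯ M(ω_1)` converge almost surely,
exponentially fast, to the rank-one operator `|ψ_S⟩⟨η_∞(ω̄)|`, where `η_∞(ω̄)` is the limit of
`ψ(ω_1) + M_Q^*(ω_1)ψ(ω_2) + ⋯ + M_Q^*(ω_1)⋯M_Q^*(ω_{n-1})ψ(ω_n)`.
Here `ω̄ = (ω̄ 0, ω̄ 1, …)` stands for `(ω_1, ω_2, …)`. -/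
theorem stmt15 {d : ℕ} (hd : 1 ≤ d) {Ω : Type*} [MeasurableSpace Ω]
    (p : Measure Ω) [IsProbabilityMeasure p]
    (M : Ω → Op d) (hMmeas : Measurable M)
    (Nrm : Seminorm ℂ (Evec d)) (hNrm : ∀ x, Nrm x = 0 → x = 0)
    (hcontr : ∀ (ω : Ω) (x : Evec d), Nrm (M ω x) ≤ Nrm x)
    (ψS : Evec d) (hψS : ‖ψS‖ = 1) (hfix : ∀ ω, M ω ψS = ψS)
    (Pb : Measure (ℕ → Ω)) [IsProbabilityMeasure Pb]
    (hPb : ∀ n : ℕ, Pb.map (fun ωb (i : Fin n) => ωb i) = Measure.pi fun _ : Fin n => p)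
    (hpos : 0 < p {ω | mcalE ψS (M ω)})
    (Φ : ℕ → (ℕ → Ω) → Op d)
    (hΦ : ∀ (n : ℕ) (ωb : ℕ → Ω),
      Φ n ωb = (List.ofFn fun i : Fin n => M (ωb (n - 1 - i))).prod)
    (η : ℕ → (ℕ → Ω) → Evec d)
    (hη : ∀ (n : ℕ) (ωb : ℕ → Ω), η n ωb =
      ∑ k ∈ Finset.range n,
        ((List.ofFn fun i : Fin k => adjoint (MQof ψS (M (ωb i)))).prod)
          (psiOf ψS (M (ωb k)))) :
    ∃ α : ℝ, 0 < α ∧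
      ∃ (Ω₄ : Set (ℕ → Ω)) (ηinf : (ℕ → Ω) → Evec d),
        Pb Ω₄ = 1 ∧
        ∀ ωb ∈ Ω₄,
          Tendsto (fun n : ℕ => η n ωb) atTop (nhds (ηinf ωb)) ∧
          ∃ C : ℝ, ∀ n : ℕ, 1 ≤ n →
            ‖Φ n ωb - ketBra ψS (ηinf ωb)‖ ≤ C * Real.exp (-α * n) := by
  obtain ⟨a₀, b₀, ha₀, hb₀, hNa, hNb⟩ := exists_norm_equiv Nrm hNrm
  obtain ⟨q, a, b, ha, hb, hq0, hqa, hqb, hq⟩ := exists_quotient_norm Nrm hNrm hψS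
  have hpow : ∀ ω k, ‖M ω ^ k‖ ≤ b₀ * a₀ := fun ω k => by
    refine ContinuousLinearMap.opNorm_le_bound _ (by positivity) fun x => ?_
    have hN : Nrm ((M ω ^ k) x) ≤ Nrm x := by
      induction k with
      | zero => simp
      | succ k ih => rw [pow_succ']; exact (hcontr ω _).trans ih
    calc ‖(M ω ^ k) x‖ ≤ b₀ * Nrm ((M ω ^ k) x) := hNb _
      _ ≤ b₀ * (a₀ * ‖x‖) := by gcongr; exact hN.trans (hNa x)
      _ = b₀ * a₀ * ‖x‖ := by ring
  have hψ := fun ω => psiOf_spec (hpow ω) hψS (hfix ω)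
  obtain ⟨_, ⟨ω₀, hω₀, rfl⟩, hsupp⟩ :
      ((M '' {ω | mcalE ψS (M ω)}) ∩ (p.map M).support).Nonempty := by
    refine Measure.nonempty_inter_support_of_pos (hpos.trans_le ?_)
    exact (measure_mono (Set.subset_preimage_image M _)).trans
      (Measure.le_map_apply hMmeas.aemeasurable _)
  set R : Op d := 1 - ketBra ψS ψS with hR
  have hRlim := hω₀.tendsto_pow hψS (hψ ω₀).1
  rw [Metric.tendsto_nhds] at hRlim
  set ε : ℝ := (2 * (a * b + 1))⁻¹ with hε
  have hε0 : 0 < ε := by positivity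
  obtain ⟨k, hk, hk0⟩ := ((hRlim ε hε0).and (eventually_gt_atTop 0)).exists
  have hU : {B : Op d | dist (R * B) 0 < ε} ∈ nhds (M ω₀ ^ k) :=
    (isOpen_lt (by fun_prop) continuous_const).mem_nhds hk
  obtain ⟨V, hV, hVprod⟩ := exists_nhds_prodSeq_mem (M ω₀) k hU
  obtain ⟨W, hWV, hWo, hW⟩ := mem_nhds_iff.1 hV
  have hA : MeasurableSet (M ⁻¹' W) := hMmeas hWo.measurableSet
  have hpA : p (M ⁻¹' W) ≠ 0 := by
    rw [← Measure.map_apply hMmeas hWo.measurableSet]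
    exact ((Measure.mem_support_iff_forall _).1 hsupp W (hWo.mem_nhds hW)).ne'
  obtain ⟨δ, hδ, hae⟩ := ae_eventually_le_card_blocks p hA hpA k
  rw [← eq_infinitePi_of_map_fin p Pb hPb] at hae
  have hα : 0 < Real.log 2 * δ / k := by
    have := Real.log_pos one_lt_two
    have : (0 : ℝ) < k := by exact_mod_cast hk0
    positivity
  have hconv : ∀ᵐ ωb ∂Pb, ∃ v : Evec d, Tendsto (fun n => η n ωb) atTop (nhds v) ∧
      ∃ C : ℝ, ∀ n, ‖Φ n ωb - ketBra ψS v‖ ≤ C * Real.exp (-(Real.log 2 * δ / k)) ^ n := by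
    filter_upwards [hae] with ωb hωb
    have hblock : ∀ j, Set.indicator {ωb : ℕ → Ω | ∀ i < k, ωb (j * k + i) ∈ M ⁻¹' W}
        (fun _ => (1 : ℝ)) ωb = 0 ∨
        Set.indicator {ωb : ℕ → Ω | ∀ i < k, ωb (j * k + i) ∈ M ⁻¹' W} (fun _ => (1 : ℝ)) ωb = 1 ∧
        ∀ x, q (prodSeq (fun i => M (ωb (j * k + i))) k x) ≤ 1 / 2 * q x := by
      intro j
      by_cases hj : ∀ i < k, ωb (j * k + i) ∈ M ⁻¹' W
      · refine Or.inr ⟨Set.indicator_of_mem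
          (s := {ωb : ℕ → Ω | ∀ i < k, ωb (j * k + i) ∈ M ⁻¹' W}) (a := ωb) hj _, fun x => ?_⟩
        set B := prodSeq (fun i => M (ωb (j * k + i))) k with hB
        have hRB : ‖R * B‖ < ε := by
          simpa using hVprod (fun i => M (ωb (j * k + i))) fun i hi => hWV (hj i hi)
        have hBψ : B ψS = ψS := prodSeq_apply_of_fixed (fun n => hfix _) k
        have hsplit : R (B x) = (R * B) (R x) := by
          simp [hR, ketBra_apply, hBψ, hψS]
          module
        calc q (B x) ≤ a * ‖R (B x)‖ := hqa _
          _ ≤ a * (ε * (b * q x)) := by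
              rw [hsplit]
              gcongr
              exact (ContinuousLinearMap.le_opNorm _ _).trans
                (mul_le_mul hRB.le (hqb x) (norm_nonneg _) hε0.le)
          _ = (a * b * ε) * q x := by ring
          _ ≤ 1 / 2 * q x := by
              gcongr
              · exact hq0 x
              · rw [hε, ← div_eq_mul_inv, div_le_div_iff₀ (by positivity) two_pos]
                linarith
      · exact Or.inl (Set.indicator_of_notMem
          (s := {ωb : ℕ → Ω | ∀ i < k, ωb (j * k + i) ∈ M ⁻¹' W}) (a := ωb) hj _)
    obtain ⟨C, hC⟩ := exists_norm_mul_prodSeq_le (ψ := ψS) (T := fun n => M (ωb n)) ha hb hq0 hqa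
      hqb (fun n => hq _ (hcontr _) (hfix _)) hk0 hblock hδ hωb
    obtain ⟨v, hv, C', hC'⟩ := exists_tendsto_and_norm_sub_ketBra_le hψS
      (T := fun n => M (ωb n)) (fun n => hfix _) (fun n => (hψ (ωb n)).1)
      (fun n => (hψ (ωb n)).2) (Real.exp_pos _) (Real.exp_lt_one_iff.2 (neg_neg_of_pos hα)) hC
    refine ⟨v, hv.congr fun n => ?_, C', fun n => ?_⟩
    · rw [hη]
      refine Finset.sum_congr rfl fun k _ => ?_
      rw [prod_ofFn_adjoint (fun i => MQof ψS (M (ωb i)))]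
      simp only [MQof_eq_sub_ketBra (hfix _) (hψ _).1]
    · rw [hΦ, ← prodSeq_eq_prod_ofFn (fun i => M (ωb i))]
      exact hC' n
  choose! ηinf hηinf using fun (ωb : ℕ → Ω) (h : ∃ v : Evec d,
    Tendsto (fun n => η n ωb) atTop (nhds v) ∧
      ∃ C : ℝ, ∀ n, ‖Φ n ωb - ketBra ψS v‖ ≤ C * Real.exp (-(Real.log 2 * δ / k)) ^ n) => h
  refine ⟨Real.log 2 * δ / k, hα, _, ηinf, mem_ae_iff_prob_eq_one₀ ?_ |>.1 hconv,
    fun ωb hωb => ⟨(hηinf ωb hωb).1, ?_⟩⟩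
  · exact NullMeasurableSet.of_compl (NullMeasurableSet.of_null (mem_ae_iff.1 hconv))
  · obtain ⟨C, hC⟩ := (hηinf ωb hωb).2
    refine ⟨C, fun n _ => (hC n).trans_eq ?_⟩
    rw [← Real.exp_nat_mul, mul_comm (n : ℝ)]
end
end
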